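/- If B is taut, then the hereditary closure (X̃_η, S) of the B-free subshift has the Myhill property: every pre-injective cellular automaton on (X̃_η, S) is surjective. -/

import Mathlib

open Filter Set

noncomputable section

/-- The shift by `t`: `(shiftPow t x) n = x (n + t)`, i.e. `S^t`. -/
def shiftPow (t : ℤ) (x : ℤ → Bool) : ℤ → Bool := fun n => x (n + t)

/-- The left shift `S`, `(S x) n = x (n + 1)`. -/
def shift : (ℤ → Bool) → (ℤ → Bool) := shiftPow 1

/-- The support of a `0-1`-sequence. -/
def supp (x : ℤ → Bool) : Set ℤ := {n | x n = true}

/-- The all-zero sequence `0^ℤ`. -/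
def zeroSeq : ℤ → Bool := fun _ => false

/-- The all-one sequence `1^ℤ`. -/
def oneSeq : ℤ → Bool := fun _ => true

/-- The sequence `u = 0^{-ℕ} 1 0^{ℕ}` with a single `1` at position `0`. -/
def uSeq : ℤ → Bool := fun n => if n = 0 then true else false

/-- The set `F_B ⊆ ℤ` of `B`-free integers. -/
def BFreeSet (B : Set ℕ) : Set ℤ := {n | ∀ b ∈ B, ¬ ((b : ℤ) ∣ n)}

open Classical in
/-- `η`, the indicator function of the `B`-free integers. -/
noncomputable def eta (B : Set ℕ) : ℤ → Bool := fun n => if n ∈ BFreeSet B then true else false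

/-- The `B`-free subshift `X_η`: the orbit closure of `η` under the shift. -/
def Xeta (B : Set ℕ) : Set (ℤ → Bool) := closure {x | ∃ t : ℤ, x = shiftPow t (eta B)}

/-- A set `A ⊆ ℤ` is `B`-admissible if for every `b ∈ B` some residue class
mod `b` is disjoint from `A`. -/
def IsBAdmissible (B : Set ℕ) (A : Set ℤ) : Prop :=
  ∀ b ∈ B, ∃ r : ℤ, ∀ a ∈ A, ¬ ((b : ℤ) ∣ (a - r))

/-- The `B`-admissible subshift `X_B`. -/
def XB (B : Set ℕ) : Set (ℤ → Bool) := {x | IsBAdmissible B (supp x)}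

/-- `B` is primitive: no element divides a different element. -/
def Primitive (B : Set ℕ) : Prop := ∀ a ∈ B, ∀ b ∈ B, a ∣ b → a = b

/-- `B` is an Erdős set: infinite, `1 ∉ B` (elements positive), primitive, pairwise
coprime and thin. -/
def IsErdos (B : Set ℕ) : Prop :=
  B.Infinite ∧ (∀ b ∈ B, 2 ≤ b) ∧ Primitive B ∧
    (∀ a ∈ B, ∀ b ∈ B, a ≠ b → Nat.Coprime a b) ∧
    Summable (fun b : B => (1 : ℝ) / (b : ℝ))

/-- A cellular automaton on `X`: a continuous self-map of `X` commuting with the shift. -/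
def IsCA (X : Set (ℤ → Bool)) (τ : (ℤ → Bool) → (ℤ → Bool)) : Prop :=
  Set.MapsTo τ X X ∧ ContinuousOn τ X ∧ ∀ x ∈ X, τ (shift x) = shift (τ x)

/-- Pre-injectivity of a CA on `X`. -/
def PreInjective (X : Set (ℤ → Bool)) (τ : (ℤ → Bool) → (ℤ → Bool)) : Prop :=
  ∀ x ∈ X, ∀ y ∈ X, τ x = τ y → {n : ℤ | x n ≠ y n}.Finite → x = y

/-- `X` is hereditary. -/
def Hereditary (X : Set (ℤ → Bool)) : Prop :=
  ∀ x ∈ X, ∀ y : ℤ → Bool, (∀ n, y n ≤ x n) → y ∈ X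

/-- The hereditary closure `X̃` of a set `X`. -/
def heredClosure (X : Set (ℤ → Bool)) : Set (ℤ → Bool) :=
  {y | ∃ x ∈ X, ∀ n, y n ≤ x n}

/-- `X` is a subshift: nonempty, closed and shift-invariant. -/
def IsSubshift (X : Set (ℤ → Bool)) : Prop :=
  X.Nonempty ∧ IsClosed X ∧ shift '' X = X

/-- `τ` is given by a (sliding block) code of radius `ℓ` on `X`. -/
def HasRadius (X : Set (ℤ → Bool)) (τ : (ℤ → Bool) → (ℤ → Bool)) (ℓ : ℕ) : Prop :=
  ∀ x ∈ X, ∀ y ∈ X, ∀ n : ℤ,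
    (∀ i : ℤ, n - ℓ ≤ i → i ≤ n + ℓ → x i = y i) → τ x n = τ y n

open Classical in
/-- `A ⊆ ℤ` has logarithmic density `d`. -/
noncomputable def HasLogDensity (A : Set ℤ) (d : ℝ) : Prop :=
  Tendsto (fun N : ℕ =>
      (Real.log N)⁻¹ * ∑ n ∈ Finset.Icc 1 N, (if (n : ℤ) ∈ A then (1 : ℝ) / (n : ℝ) else 0))
    atTop (nhds d)

/-- `B` is taut: removing any `b ∈ B` strictly increases the logarithmic density of the
`B`-free integers. -/
def IsTaut (B : Set ℕ) : Prop :=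
  ∀ b ∈ B, ∀ d d' : ℝ,
    HasLogDensity (BFreeSet B) d → HasLogDensity (BFreeSet (B \ {b})) d' → d < d'

/-- `x` and `y` are proximal: along some sequence `r k → ∞`, the shifted sequences
`S^{r k} x` and `S^{r k} y` agree on arbitrarily large central windows, i.e.
`d(S^{r k} x, S^{r k} y) → 0` in the product topology. -/
def ProximalPair (x y : ℤ → Bool) : Prop :=
  ∃ r : ℕ → ℤ, Tendsto r atTop atTop ∧
    ∀ m : ℕ, ∀ᶠ k in atTop, ∀ n : ℤ, |n| ≤ (m : ℤ) →
      shiftPow (r k) x n = shiftPow (r k) y n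

/-- A subshift is proximal if every pair of its points is proximal. -/
def IsProximalSubshift (X : Set (ℤ → Bool)) : Prop :=
  ∀ x ∈ X, ∀ y ∈ X, ProximalPair x y

end

open Classical in
/-- The partial logarithmic sum `∑_{n ≤ N, n ∈ A} 1 / n`. -/
noncomputable def logSum (A : Set ℤ) (N : ℕ) : ℝ :=
  ∑ n ∈ Finset.Icc 1 N, (if (n : ℤ) ∈ A then (1 : ℝ) / (n : ℝ) else 0)

lemma hasLogDensity_iff (A : Set ℤ) (d : ℝ) :
    HasLogDensity A d ↔ Tendsto (fun N : ℕ => (Real.log N)⁻¹ * logSum A N) atTop (nhds d) :=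
  Iff.rfl

lemma logSum_nonneg (A : Set ℤ) (N : ℕ) : 0 ≤ logSum A N :=
  Finset.sum_nonneg fun n _ => by split_ifs <;> positivity

lemma logSum_mono {A A' : Set ℤ} {N : ℕ} (h : ∀ n : ℕ, 1 ≤ n → n ≤ N → (n : ℤ) ∈ A → (n : ℤ) ∈ A') :
    logSum A N ≤ logSum A' N := by
  refine Finset.sum_le_sum fun n hn => ?_
  rw [Finset.mem_Icc] at hn
  by_cases h1 : (n : ℤ) ∈ A
  · simp [h1, h n hn.1 hn.2 h1]
  · simp only [h1, if_false]; split_ifs <;> positivity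

lemma logSum_union_le (A A' : Set ℤ) (N : ℕ) :
    logSum (A ∪ A') N ≤ logSum A N + logSum A' N := by
  unfold logSum
  rw [← Finset.sum_add_distrib]
  refine Finset.sum_le_sum fun n _ => ?_
  have : (0 : ℝ) ≤ 1 / n := by positivity
  by_cases h1 : (n : ℤ) ∈ A <;> by_cases h2 : (n : ℤ) ∈ A' <;> simp [h1, h2]

lemma logSum_biUnion_le {ι : Type*} (s : Finset ι) (A : ι → Set ℤ) (N : ℕ) :
    logSum (⋃ i ∈ s, A i) N ≤ ∑ i ∈ s, logSum (A i) N := by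
  classical
  induction s using Finset.induction_on with
  | empty => simp [logSum]
  | insert a s ha ih =>
    rw [Finset.set_biUnion_insert, Finset.sum_insert ha]
    exact (logSum_union_le _ _ _).trans (by gcongr)

lemma logSum_succ_right (A : Set ℤ) (N : ℕ) [Decidable (((N + 1 : ℕ) : ℤ) ∈ A)] :
    logSum A (N + 1) = logSum A N + if ((N + 1 : ℕ) : ℤ) ∈ A then (1 : ℝ) / ((N + 1 : ℕ) : ℝ) else 0 := by
  unfold logSum
  rw [Finset.sum_Icc_succ_top (by omega)]
  congr

lemma logSum_univ (N : ℕ) : logSum univ N = (harmonic N : ℝ) := by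
  simp [logSum, harmonic_eq_sum_Icc]

lemma tendsto_log_natCast : Tendsto (fun N : ℕ => Real.log N) atTop atTop :=
  Real.tendsto_log_atTop.comp tendsto_natCast_atTop_atTop

lemma tendsto_inv_log_mul_of_bounded {f : ℕ → ℝ} {C : ℝ} (h : ∀ N, |f N| ≤ C) :
    Tendsto (fun N : ℕ => (Real.log N)⁻¹ * f N) atTop (nhds 0) :=
  tendsto_log_natCast.inv_tendsto_atTop.zero_mul_isBoundedUnder_le
    (Filter.isBoundedUnder_of ⟨C, fun N => by simpa using h N⟩)

lemma hasLogDensity_univ : HasLogDensity univ 1 := by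
  rw [hasLogDensity_iff]
  have h1 : Tendsto (fun N : ℕ => 1 + (Real.log N)⁻¹ * (logSum univ N - Real.log N)) atTop
      (nhds (1 + 0)) := by
    refine Tendsto.add tendsto_const_nhds (tendsto_inv_log_mul_of_bounded (C := 1) fun N => ?_)
    rw [logSum_univ]
    have h2 := harmonic_le_one_add_log N
    have h3 := log_add_one_le_harmonic N
    rw [abs_le]
    rcases Nat.eq_zero_or_pos N with rfl | hN
    · simp
    · have : Real.log N ≤ Real.log (N + 1 : ℕ) := Real.log_le_log (by positivity) (by push_cast; linarith)
      constructor <;> linarith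
  rw [add_zero] at h1
  refine h1.congr' ?_
  filter_upwards [eventually_ge_atTop 2] with N hN
  have : 0 < Real.log N := Real.log_pos (by exact_mod_cast hN)
  field_simp
  ring

/-- Logarithmic sums are almost invariant under translation. -/
lemma abs_logSum_translate_one (A : Set ℤ) (N : ℕ) :
    |logSum {n | n + 1 ∈ A} N - logSum A N| ≤ 2 := by
  classical
  have key : ∀ N : ℕ, ∃ t : ℝ, 0 ≤ t ∧ t ≤ 1 - 1 / ((N : ℝ) + 1) ∧
      logSum {n | n + 1 ∈ A} N = logSum A (N + 1) - (if (1 : ℤ) ∈ A then 1 else 0) + t := by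
    intro N
    induction N with
    | zero => exact ⟨0, le_rfl, by simp, by simp [logSum]⟩
    | succ N ih =>
      obtain ⟨t, h0, h1, h2⟩ := ih
      have e : (((N + 1 + 1 : ℕ) : ℤ) ∈ A) = (((N + 1 : ℕ) : ℤ) ∈ {n | n + 1 ∈ A}) := by simp
      have hp : (0 : ℝ) < N + 1 := by positivity
      have hd : 1 / ((N : ℝ) + 1 + 1) ≤ 1 / ((N : ℝ) + 1) := by gcongr; linarith
      rw [logSum_succ_right _ N, h2, logSum_succ_right _ (N + 1)]
      by_cases h : (((N + 1 : ℕ) : ℤ) ∈ {n | n + 1 ∈ A})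
      · refine ⟨t + (1 / ((N : ℝ) + 1) - 1 / ((N : ℝ) + 1 + 1)), by linarith, by push_cast; linarith, ?_⟩
        simp only [e, h, if_true]; push_cast; ring
      · refine ⟨t, h0, by push_cast; linarith, ?_⟩
        simp only [e, h, if_false]; ring
  obtain ⟨t, h0, h1, h2⟩ := key N
  rw [h2, logSum_succ_right]
  have hp : (0 : ℝ) < 1 / (N + 1) := by positivity
  have hp' : 1 / ((N : ℝ) + 1) ≤ 1 := by rw [div_le_one] <;> linarith [(Nat.cast_nonneg N : (0 : ℝ) ≤ N)]
  rw [abs_le]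
  push_cast
  split_ifs <;> constructor <;> linarith

lemma abs_logSum_translate (A : Set ℤ) (k N : ℕ) :
    |logSum {n | n + k ∈ A} N - logSum A N| ≤ 2 * k := by
  induction k with
  | zero => simp
  | succ k ih =>
    have h := abs_logSum_translate_one {n | n + k ∈ A} N
    have e : {n : ℤ | n + 1 ∈ {n : ℤ | n + k ∈ A}} = {n : ℤ | n + ((k + 1 : ℕ) : ℤ) ∈ A} := by
      ext n; simp only [mem_ofPred_eq]; push_cast; ring_nf
    rw [e] at h
    have e2 : (2 : ℝ) * ((k + 1 : ℕ) : ℝ) = 2 * k + 2 := by push_cast; ring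
    rw [e2]
    rw [abs_le] at *
    constructor <;> linarith [h.1, h.2, ih.1, ih.2]

lemma sum_logSum_residues (e : ℕ) (he : 0 < e) (c : ℤ) (N : ℕ) :
    ∑ k ∈ Finset.range e, logSum {n : ℤ | n + k ∈ {n : ℤ | (e : ℤ) ∣ n - c}} N = logSum univ N := by
  classical
  unfold logSum
  rw [Finset.sum_comm]
  refine Finset.sum_congr rfl fun n _ => ?_
  have he' : (0 : ℤ) < e := by exact_mod_cast he
  rw [Finset.sum_eq_single ((c - n) % e).toNat]
  · have h1 : (((c - n) % e).toNat : ℤ) = (c - n) % e := Int.toNat_of_nonneg (Int.emod_nonneg _ he'.ne')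
    have : (e : ℤ) ∣ n + (((c - n) % e).toNat : ℤ) - c := by
      rw [h1, ← dvd_neg]
      have := Int.dvd_self_sub_emod (x := c - n) (m := e)
      rwa [show -((n : ℤ) + (c - n) % e - c) = c - n - (c - n) % e by ring]
    simp only [mem_ofPred_eq, this, if_true, mem_univ]
  · intro k hk hne
    rw [if_neg]
    intro h
    apply hne
    simp only [mem_ofPred_eq] at h
    rw [Finset.mem_range] at hk
    have h2 : ((k : ℤ)) % e = (c - n) % e := by
      apply Int.ModEq.eq
      apply Int.ModEq.symm
      rw [Int.modEq_iff_dvd]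
      convert h using 1; ring
    rw [← h2, Int.emod_eq_of_lt (by positivity) (by exact_mod_cast hk)]; simp
  · intro h
    exfalso; apply h
    rw [Finset.mem_range, Int.toNat_lt (Int.emod_nonneg _ he'.ne')]
    exact Int.emod_lt_of_pos _ he'

/-- Residue classes modulo `e` have logarithmic density `1 / e`. -/
lemma hasLogDensity_residue (e : ℕ) (he : 0 < e) (c : ℤ) :
    HasLogDensity {n : ℤ | (e : ℤ) ∣ n - c} (1 / e) := by
  rw [hasLogDensity_iff]
  set A := {n : ℤ | (e : ℤ) ∣ n - c}
  have he' : (0 : ℝ) < e := by exact_mod_cast he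
  have h1 := tendsto_inv_log_mul_of_bounded (f := fun N => (e : ℝ) * logSum A N - logSum univ N)
    (C := ∑ k ∈ Finset.range e, 2 * (k : ℝ)) (fun N => by
      rw [← sum_logSum_residues e he c N, abs_sub_comm]
      have : (e : ℝ) * logSum A N = ∑ k ∈ Finset.range e, logSum A N := by simp
      rw [this, ← Finset.sum_sub_distrib]
      exact (Finset.abs_sum_le_sum_abs _ _).trans (Finset.sum_le_sum fun k _ => abs_logSum_translate A k N))
  have h2 := (h1.add ((hasLogDensity_iff _ _).1 hasLogDensity_univ)).const_mul (1 / (e : ℝ))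
  rw [zero_add, mul_one] at h2
  refine h2.congr fun N => ?_
  field_simp
  ring

/-- The density of the integers free of all elements of the finite set `D`, as given by
inclusion-exclusion. -/
noncomputable def sieveDensity (D : Finset ℕ) : ℝ :=
  ∑ E ∈ D.powerset, (-1) ^ E.card / ((E.lcm id : ℕ) : ℝ)

lemma coe_lcm_dvd_iff (E : Finset ℕ) (n : ℤ) :
    ((E.lcm id : ℕ) : ℤ) ∣ n ↔ ∀ b ∈ E, (b : ℤ) ∣ n := by
  simp [Int.natCast_dvd, Finset.lcm_dvd_iff]

open Classical in
lemma indicator_BFreeSet (D : Finset ℕ) (n : ℤ) :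
    (if n ∈ BFreeSet (D : Set ℕ) then (1 : ℝ) else 0) =
      ∑ E ∈ D.powerset, (-1) ^ E.card * (if ((E.lcm id : ℕ) : ℤ) ∣ n then (1 : ℝ) else 0) := by
  have h1 : (if n ∈ BFreeSet (D : Set ℕ) then (1 : ℝ) else 0) =
      ∏ b ∈ D, (1 + -(if (b : ℤ) ∣ n then (1 : ℝ) else 0)) := by
    by_cases h : n ∈ BFreeSet (D : Set ℕ)
    · rw [if_pos h, Finset.prod_eq_one]
      intro b hb
      rw [if_neg (h b (by simpa using hb))]; simp
    · rw [if_neg h]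
      simp only [BFreeSet, mem_ofPred_eq, not_forall, not_not] at h
      obtain ⟨b, hb, hd⟩ := h
      rw [Finset.prod_eq_zero (i := b) (by simpa using hb)]
      rw [if_pos hd]; simp
  rw [h1, Finset.prod_one_add]
  refine Finset.sum_congr rfl fun E _ => ?_
  rw [Finset.prod_neg]
  congr 1
  rw [Finset.prod_ite_zero, Finset.prod_const_one]
  simp only [coe_lcm_dvd_iff]

lemma lcm_id_pos {E : Finset ℕ} (h : ∀ b ∈ E, 0 < b) : 0 < E.lcm id := by
  rw [Nat.pos_iff_ne_zero, Ne, Finset.lcm_eq_zero_iff]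
  simp only [id, not_exists, not_and]
  intro b hb hb0
  exact (h b (by simpa using hb)).ne' hb0

lemma coprime_lcm_id {E : Finset ℕ} {L : ℕ} (h : ∀ b ∈ E, Nat.Coprime b L) :
    Nat.Coprime (E.lcm id) L := by
  induction E using Finset.induction_on with
  | empty => simp
  | insert a s ha ih =>
    rw [Finset.lcm_insert]
    exact Nat.Coprime.coprime_dvd_left (Nat.lcm_dvd_mul _ _)
      (Nat.Coprime.mul_left (h a (by simp)) (ih fun b hb => h b (by simp [hb])))

lemma hasLogDensity_dvd_linear {e L : ℕ} (he : 0 < e) (h : Nat.Coprime e L) (r : ℤ) :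
    HasLogDensity {s : ℤ | (e : ℤ) ∣ r + L * s} (1 / e) := by
  obtain ⟨u, v, huv⟩ := Nat.isCoprime_iff_coprime.2 h
  convert hasLogDensity_residue e he (-r * v) using 1
  ext s
  simp only [mem_ofPred_eq]
  have : r + L * s = L * (s - -r * v) + e * (r * u) := by linear_combination (-r) * huv
  rw [this, Int.dvd_add_left (Dvd.intro _ rfl)]
  constructor
  · exact fun h2 => (Nat.isCoprime_iff_coprime.2 h).dvd_of_dvd_mul_left h2
  · exact fun h2 => Dvd.dvd.mul_left h2 _

lemma logSum_BFree_linear (D : Finset ℕ) (L : ℕ) (r : ℤ) (N : ℕ) :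
    logSum {s : ℤ | r + L * s ∈ BFreeSet (D : Set ℕ)} N =
      ∑ E ∈ D.powerset, (-1) ^ E.card * logSum {s : ℤ | ((E.lcm id : ℕ) : ℤ) ∣ r + L * s} N := by
  classical
  unfold logSum
  simp_rw [Finset.mul_sum]
  rw [Finset.sum_comm]
  refine Finset.sum_congr rfl fun n _ => ?_
  have h := congrArg (fun x : ℝ => x * (1 / (n : ℝ))) (indicator_BFreeSet D (r + L * n))
  simp only [ite_mul, one_mul, zero_mul, Finset.sum_mul, mul_assoc] at h
  have e1 : (n : ℤ) ∈ {s : ℤ | r + L * s ∈ BFreeSet (D : Set ℕ)} ↔ r + L * n ∈ BFreeSet (D : Set ℕ) :=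
    Iff.rfl
  have e2 : ∀ E : Finset ℕ, (n : ℤ) ∈ {s : ℤ | ((E.lcm id : ℕ) : ℤ) ∣ r + L * s} ↔
      ((E.lcm id : ℕ) : ℤ) ∣ r + L * n := fun _ => Iff.rfl
  simp only [e1, e2]
  convert h

/-- Along a progression of modulus coprime to `D`, the `D`-free integers have density
`sieveDensity D`. -/
lemma hasLogDensity_BFree_linear {D : Finset ℕ} {L : ℕ} (hD : ∀ b ∈ D, 0 < b)
    (h : ∀ b ∈ D, Nat.Coprime b L) (r : ℤ) :
    HasLogDensity {s : ℤ | r + L * s ∈ BFreeSet (D : Set ℕ)} (sieveDensity D) := by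
  rw [hasLogDensity_iff]
  simp_rw [logSum_BFree_linear, Finset.mul_sum]
  refine tendsto_finsetSum _ fun E hE => ?_
  rw [Finset.mem_powerset] at hE
  have h1 := (hasLogDensity_iff _ _).1 (hasLogDensity_dvd_linear (lcm_id_pos fun b hb => hD b (hE hb))
    (coprime_lcm_id fun b hb => h b (hE hb)) r)
  have h2 := h1.const_mul ((-1 : ℝ) ^ E.card)
  rw [mul_one_div] at h2
  exact h2.congr fun N => by ring

lemma hasLogDensity_BFree_finset {D : Finset ℕ} (hD : ∀ b ∈ D, 0 < b) :
    HasLogDensity (BFreeSet (D : Set ℕ)) (sieveDensity D) := by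
  simpa using hasLogDensity_BFree_linear (L := 1) hD (by simp) 0

lemma HasLogDensity.nonneg {A : Set ℤ} {d : ℝ} (h : HasLogDensity A d) : 0 ≤ d := by
  rw [hasLogDensity_iff] at h
  exact ge_of_tendsto' h fun N => mul_nonneg (inv_nonneg.2 (Real.log_natCast_nonneg N)) (logSum_nonneg A N)

lemma HasLogDensity.mono {A A' : Set ℤ} {d d' : ℝ} (h : HasLogDensity A d) (h' : HasLogDensity A' d')
    (hs : A ⊆ A') : d ≤ d' := by
  rw [hasLogDensity_iff] at h h'
  refine le_of_tendsto_of_tendsto' h h' fun N => ?_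
  exact mul_le_mul_of_nonneg_left (logSum_mono fun n _ _ hn => hs hn) (inv_nonneg.2 (Real.log_natCast_nonneg N))

lemma sieveDensity_nonneg {D : Finset ℕ} (hD : ∀ b ∈ D, 0 < b) : 0 ≤ sieveDensity D :=
  (hasLogDensity_BFree_finset hD).nonneg

lemma BFreeSet_anti {B B' : Set ℕ} (h : B ⊆ B') : BFreeSet B' ⊆ BFreeSet B :=
  fun _ hn b hb => hn b (h hb)

lemma sieveDensity_anti {D D' : Finset ℕ} (hD' : ∀ b ∈ D', 0 < b) (h : D ⊆ D') :
    sieveDensity D' ≤ sieveDensity D :=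
  (hasLogDensity_BFree_finset hD').mono (hasLogDensity_BFree_finset fun b hb => hD' b (h hb))
    (BFreeSet_anti (by exact_mod_cast h))

/-- Coprime sets of divisors sieve independently. -/
lemma sieveDensity_union {D D' : Finset ℕ} (hdisj : Disjoint D D')
    (hcop : ∀ b ∈ D', Nat.Coprime b (D.lcm id)) :
    sieveDensity (D ∪ D') = sieveDensity D * sieveDensity D' := by
  unfold sieveDensity
  rw [Finset.sum_mul_sum, ← Finset.sum_product']
  symm
  refine Finset.sum_nbij' (fun p => p.1 ∪ p.2) (fun E => (E ∩ D, E ∩ D')) ?_ ?_ ?_ ?_ ?_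
  · intro p hp
    simp only [Finset.mem_product, Finset.mem_powerset] at hp ⊢
    exact Finset.union_subset_union hp.1 hp.2
  · intro E _
    simp
  · rintro ⟨E, E'⟩ hp
    simp only [Finset.mem_product, Finset.mem_powerset] at hp
    have h1 : Disjoint E' D := (hdisj.mono_right hp.2).symm
    have h2 : Disjoint E D' := hdisj.mono_left hp.1
    simp only [Prod.mk.injEq, Finset.union_inter_distrib_right]
    rw [Finset.disjoint_iff_inter_eq_empty.1 h1, Finset.disjoint_iff_inter_eq_empty.1 h2]
    simp [Finset.inter_eq_left.2 hp.1, Finset.inter_eq_left.2 hp.2]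
  · intro E hE
    rw [Finset.mem_powerset] at hE
    simp only [← Finset.inter_union_distrib_left]
    exact Finset.inter_eq_left.2 hE
  · rintro ⟨E, E'⟩ hp
    simp only [Finset.mem_product, Finset.mem_powerset] at hp
    have h1 : Disjoint E E' := hdisj.mono hp.1 hp.2
    have h2 : Nat.Coprime (E.lcm id) (E'.lcm id) := by
      refine Nat.Coprime.symm (coprime_lcm_id fun b hb => ?_)
      exact (hcop b (hp.2 hb)).coprime_dvd_right (Finset.lcm_mono hp.1)
    rw [Finset.card_union_of_disjoint h1, Finset.lcm_union, pow_add]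
    have : (GCDMonoid.lcm (E.lcm id) (E'.lcm id) : ℕ) = E.lcm id * E'.lcm id := h2.lcm_eq_mul
    rw [this]
    push_cast
    rw [div_mul_div_comm]

lemma sum_log_primeFactors_le {m : ℕ} (hm : m ≠ 0) :
    ∑ p ∈ m.primeFactors, Real.log p ≤ Real.log m := by
  rw [← Real.log_prod (fun p hp => by
    have := (Nat.prime_of_mem_primeFactors hp).pos
    positivity)]
  have h1 : 0 < ∏ p ∈ m.primeFactors, (p : ℝ) :=
    Finset.prod_pos fun p hp => by exact_mod_cast (Nat.prime_of_mem_primeFactors hp).pos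
  refine Real.log_le_log h1 ?_
  rw [← Nat.cast_prod, Nat.cast_le]
  exact Nat.le_of_dvd (Nat.pos_of_ne_zero hm) (Nat.prod_primeFactors_dvd m)

/-- Mertens' first theorem (upper bound). -/
lemma sum_log_div_prime_le (n : ℕ) (hn : 0 < n) :
    ∑ p ∈ (n + 1).primesBelow, Real.log p / p ≤ Real.log n + Real.log 4 := by
  have hn' : (0 : ℝ) < n := by exact_mod_cast hn
  have h1 : ∑ m ∈ Finset.Ioc 0 n, ∑ p ∈ m.primeFactors, Real.log p ≤ n * Real.log n := by
    calc _ ≤ ∑ m ∈ Finset.Ioc 0 n, Real.log n := by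
          refine Finset.sum_le_sum fun m hm => ?_
          rw [Finset.mem_Ioc] at hm
          refine (sum_log_primeFactors_le hm.1.ne').trans (Real.log_le_log ?_ ?_)
          · exact_mod_cast hm.1
          · exact_mod_cast hm.2
      _ = n * Real.log n := by simp
  have h2 : ∑ m ∈ Finset.Ioc 0 n, ∑ p ∈ m.primeFactors, Real.log p =
      ∑ p ∈ (n + 1).primesBelow, ((n / p : ℕ) : ℝ) * Real.log p := by
    have : ∀ m ∈ Finset.Ioc 0 n, ∑ p ∈ m.primeFactors, Real.log p =
        ∑ p ∈ (n + 1).primesBelow, if p ∣ m then Real.log p else 0 := by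
      intro m hm
      rw [Finset.mem_Ioc] at hm
      rw [← Finset.sum_filter]
      refine Finset.sum_congr ?_ fun _ _ => rfl
      ext p
      simp only [Nat.mem_primeFactors, Finset.mem_filter, Nat.mem_primesBelow]
      constructor
      · rintro ⟨a, b, c⟩
        exact ⟨⟨Nat.lt_succ_of_le ((Nat.le_of_dvd hm.1 b).trans hm.2), a⟩, b⟩
      · rintro ⟨⟨a, b⟩, c⟩
        exact ⟨b, c, hm.1.ne'⟩
    rw [Finset.sum_congr rfl this, Finset.sum_comm]
    refine Finset.sum_congr rfl fun p _ => ?_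
    rw [← Finset.sum_filter, Finset.sum_const, Nat.Ioc_filter_dvd_card_eq_div, nsmul_eq_mul]
  have h3 : ∑ p ∈ (n + 1).primesBelow, Real.log p ≤ Real.log 4 * n := by
    have := Chebyshev.theta_le_log4_mul_x (x := n) hn'.le
    rw [Chebyshev.theta_eq_sum_primesLE_log] at this
    exact this
  have h4 : ∑ p ∈ (n + 1).primesBelow, ((n : ℝ) * (Real.log p / p) - Real.log p) ≤
      ∑ p ∈ (n + 1).primesBelow, ((n / p : ℕ) : ℝ) * Real.log p := by
    refine Finset.sum_le_sum fun p hp => ?_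
    have hlog : 0 ≤ Real.log p := Real.log_natCast_nonneg p
    have : (n : ℝ) / p < (n / p : ℕ) + 1 := by
      have := Nat.lt_floor_add_one ((n : ℝ) / p)
      rwa [Nat.floor_div_eq_div] at this
    have e : (n : ℝ) * (Real.log p / p) - Real.log p = (n / p - 1) * Real.log p := by ring
    rw [e]
    exact mul_le_mul_of_nonneg_right (by linarith) hlog
  rw [Finset.sum_sub_distrib, ← Finset.mul_sum] at h4
  have h5 : (n : ℝ) * ∑ p ∈ (n + 1).primesBelow, Real.log p / p ≤ n * (Real.log n + Real.log 4) := by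
    linarith
  exact le_of_mul_le_mul_left h5 hn'

/-- The sum of the reciprocals of the `N`-smooth numbers, as an Euler product. -/
noncomputable def smoothMass (N : ℕ) : ℝ := ∏ p ∈ (N + 1).primesBelow, (1 - (p : ℝ)⁻¹)⁻¹

lemma euler_factor_le {p : ℕ} (hp : p.Prime) {δ : ℝ} (hδ : 0 < δ) :
    (1 - (p : ℝ)⁻¹)⁻¹ ≤ Real.exp (2 * δ * (Real.log p / p)) * (1 - (p : ℝ) ^ (-(1 + δ)))⁻¹ := by
  have hp2 : (2 : ℝ) ≤ p := by exact_mod_cast hp.two_le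
  have hp0 : (0 : ℝ) < p := by linarith
  have hinv : (p : ℝ)⁻¹ ≤ 1 / 2 := by rw [inv_le_comm₀ hp0 (by norm_num)]; linarith
  have hinv0 : 0 < (p : ℝ)⁻¹ := by positivity
  have hlog : 0 ≤ Real.log p := Real.log_nonneg (by linarith)
  have hpow : (p : ℝ) ^ (-(1 + δ)) = (p : ℝ)⁻¹ * Real.exp (-(δ * Real.log p)) := by
    rw [neg_add, Real.rpow_add hp0, Real.rpow_neg_one, Real.rpow_def_of_pos hp0]
    congr 2; ring
  have h1 : (p : ℝ)⁻¹ * (1 - δ * Real.log p) ≤ (p : ℝ) ^ (-(1 + δ)) := by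
    rw [hpow]
    refine mul_le_mul_of_nonneg_left ?_ hinv0.le
    have := Real.add_one_le_exp (-(δ * Real.log p)); linarith
  have h2 : (p : ℝ) ^ (-(1 + δ)) < 1 := by
    rw [hpow]
    have : Real.exp (-(δ * Real.log p)) ≤ 1 := Real.exp_le_one_iff.2 (by nlinarith [mul_nonneg hδ.le hlog])
    nlinarith
  have hx : 0 ≤ δ * (Real.log p / p) := by positivity
  have h3 : 1 - (p : ℝ) ^ (-(1 + δ)) ≤ (1 - (p : ℝ)⁻¹) * Real.exp (2 * δ * (Real.log p / p)) := by
    have h4 := Real.add_one_le_exp (2 * δ * (Real.log p / p))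
    have h5 : 1 - (p : ℝ) ^ (-(1 + δ)) ≤ 1 - (p : ℝ)⁻¹ + δ * (Real.log p / p) := by
      have : (p : ℝ)⁻¹ * (1 - δ * Real.log p) = (p : ℝ)⁻¹ - δ * (Real.log p / p) := by
        field_simp
      linarith
    nlinarith
  rw [inv_eq_one_div, ← div_eq_mul_inv, div_le_div_iff₀ (by linarith) (by linarith)]
  linarith

lemma exists_smoothMass_le : ∃ K : ℝ, 0 < K ∧ ∀ᶠ N : ℕ in atTop, smoothMass N ≤ K * Real.log N := by
  have hlim : Tendsto (fun N : ℕ => 1 + (Real.log N)⁻¹) atTop (nhdsWithin 1 (Ioi 1)) := by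
    refine tendsto_nhdsWithin_iff.2 ⟨?_, ?_⟩
    · simpa using (tendsto_log_natCast.inv_tendsto_atTop).const_add 1
    · filter_upwards [eventually_ge_atTop 2] with N hN
      have : 0 < Real.log N := Real.log_pos (by exact_mod_cast hN)
      simp only [mem_Ioi]
      linarith [inv_pos.2 this]
  have hz := (tendsto_sub_mul_tsum_nat_rpow.comp hlim).eventually_le_const (by norm_num : (1 : ℝ) < 2)
  refine ⟨Real.exp (2 * (1 + 2 * Real.log 4)) * 2, by positivity, ?_⟩
  filter_upwards [hz, eventually_ge_atTop 2] with N hN hN2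
  have hlogN : 0 < Real.log N := Real.log_pos (by exact_mod_cast hN2)
  set δ := (Real.log N)⁻¹ with hδ
  have hδ0 : 0 < δ := inv_pos.2 hlogN
  have hsum : Summable fun n : ℕ => 1 / (n : ℝ) ^ (1 + δ) :=
    Real.summable_one_div_nat_rpow.2 (by linarith)
  simp only [Function.comp_def, add_sub_cancel_left] at hN
  let f : ℕ →* ℝ :=
    { toFun := fun n => (n : ℝ) ^ (-(1 + δ))
      map_one' := by simp
      map_mul' := fun a b => by push_cast; exact Real.mul_rpow (by positivity) (by positivity) }
  have hf := (EulerProduct.summable_and_hasSum_smoothNumbers_prod_primesBelow_geometric (f := f)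
    (fun {p} hp => by
      have h1 : (1 : ℝ) < p := by exact_mod_cast hp.one_lt
      have h2 : f p = (p : ℝ) ^ (-(1 + δ)) := rfl
      rw [h2, Real.norm_of_nonneg (by positivity)]
      exact Real.rpow_lt_one_of_one_lt_of_neg h1 (by linarith)) (N + 1)).2
  have hle : ∏ p ∈ (N + 1).primesBelow, (1 - (p : ℝ) ^ (-(1 + δ)))⁻¹ ≤ ∑' n : ℕ, 1 / (n : ℝ) ^ (1 + δ) := by
    have e : ∀ n : ℕ, f n = 1 / (n : ℝ) ^ (1 + δ) := fun n => by
      rw [one_div, ← Real.rpow_neg (by positivity)]; rfl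
    have h1 := hf.tsum_eq
    rw [show ∏ p ∈ (N + 1).primesBelow, (1 - (p : ℝ) ^ (-(1 + δ)))⁻¹ =
      ∏ p ∈ (N + 1).primesBelow, (1 - f p)⁻¹ from rfl, ← h1]
    simp_rw [e]
    exact hsum.tsum_subtype_le (fun n : ℕ => 1 / (n : ℝ) ^ (1 + δ)) _ (fun n => by positivity)
  have hM := sum_log_div_prime_le N (by omega)
  calc smoothMass N
      ≤ ∏ p ∈ (N + 1).primesBelow, (Real.exp (2 * δ * (Real.log p / p)) * (1 - (p : ℝ) ^ (-(1 + δ)))⁻¹) := by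
        refine Finset.prod_le_prod (fun p hp => ?_) fun p hp =>
          euler_factor_le (Nat.prime_of_mem_primesBelow hp) hδ0
        have : (1 : ℝ) ≤ p := by exact_mod_cast (Nat.prime_of_mem_primesBelow hp).one_le
        exact inv_nonneg.2 (sub_nonneg.2 (inv_le_one_of_one_le₀ this))
    _ = Real.exp (2 * δ * ∑ p ∈ (N + 1).primesBelow, (Real.log p / p)) *
          ∏ p ∈ (N + 1).primesBelow, (1 - (p : ℝ) ^ (-(1 + δ)))⁻¹ := by
        rw [Finset.prod_mul_distrib, Finset.mul_sum, Real.exp_sum]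
    _ ≤ Real.exp (2 * (1 + 2 * Real.log 4)) * (2 * Real.log N) := by
        refine mul_le_mul (Real.exp_le_exp.2 ?_) ?_ ?_ (by positivity)
        · rw [mul_assoc]
          refine mul_le_mul_of_nonneg_left ?_ (by norm_num)
          have h2 : Real.log 2 ≤ Real.log N := Real.log_le_log (by norm_num) (by exact_mod_cast hN2)
          have h4 : Real.log 4 = 2 * Real.log 2 := by
            rw [show (4 : ℝ) = 2 ^ 2 by norm_num, Real.log_pow]; norm_num
          have h5 : Real.log N + Real.log 4 ≤ Real.log N * (1 + 2 * Real.log 4) := by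
            have h6 : (1:ℝ) / 2 ≤ Real.log N := by linarith [Real.log_two_gt_d9]
            have h7 : 0 ≤ Real.log 4 := Real.log_nonneg (by norm_num)
            nlinarith
          rw [hδ, inv_mul_le_iff₀ hlogN]
          linarith
        · refine hle.trans ?_
          rw [inv_mul_le_iff₀ hlogN] at hN
          linarith
        · refine Finset.prod_nonneg fun p hp => ?_
          have : (1 : ℝ) ≤ p := by exact_mod_cast (Nat.prime_of_mem_primesBelow hp).one_le
          exact inv_nonneg.2 (sub_nonneg.2 (Real.rpow_le_one_of_one_le_of_nonpos this (by linarith)))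
    _ = Real.exp (2 * (1 + 2 * Real.log 4)) * 2 * Real.log N := by ring

lemma hasSum_smooth_inv (N : ℕ) :
    HasSum (fun m : (N + 1).smoothNumbers => ((m : ℕ) : ℝ)⁻¹) (smoothMass N) := by
  let f : ℕ →* ℝ :=
    { toFun := fun n => (n : ℝ)⁻¹
      map_one' := by simp
      map_mul' := fun a b => by push_cast; exact mul_inv _ _ }
  exact (EulerProduct.summable_and_hasSum_smoothNumbers_prod_primesBelow_geometric (f := f)
    (fun {p} hp => by
      have h1 : (1 : ℝ) < p := by exact_mod_cast hp.one_lt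
      have h2 : f p = (p : ℝ)⁻¹ := rfl
      rw [h2, Real.norm_of_nonneg (by positivity)]
      exact inv_lt_one_of_one_lt₀ h1) (N + 1)).2

lemma hasSum_smooth_dvd {N e : ℕ} (he : e ∈ (N + 1).smoothNumbers) :
    HasSum (fun m : (N + 1).smoothNumbers => if (e : ℤ) ∣ ((m : ℕ) : ℤ) then ((m : ℕ) : ℝ)⁻¹ else 0)
      (smoothMass N / e) := by
  have he0 : e ≠ 0 := Nat.ne_zero_of_mem_smoothNumbers he
  let g : (N + 1).smoothNumbers → (N + 1).smoothNumbers :=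
    fun m => ⟨e * m, Nat.mul_mem_smoothNumbers he m.2⟩
  have hg : Function.Injective g := fun a b hab => by
    have : e * (a : ℕ) = e * b := congrArg Subtype.val hab
    exact Subtype.ext (Nat.eq_of_mul_eq_mul_left (Nat.pos_of_ne_zero he0) this)
  rw [← hg.hasSum_iff]
  · have h := (hasSum_smooth_inv N).mul_right (e : ℝ)⁻¹
    rw [← div_eq_mul_inv] at h
    refine (congrArg (HasSum · _) (funext fun m => ?_)).mp h
    have h1 : ((g m : ℕ) : ℤ) = e * (m : ℕ) := Nat.cast_mul _ _
    have h2 : ((g m : ℕ) : ℝ) = e * (m : ℕ) := Nat.cast_mul _ _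
    rw [Function.comp_apply, if_pos (h1 ▸ Dvd.intro _ rfl), h2, mul_inv, mul_comm]
  · intro m hm
    rw [if_neg]
    intro hd
    rw [Int.natCast_dvd_natCast] at hd
    obtain ⟨k, hk⟩ := hd
    exact hm ⟨⟨k, Nat.mem_smoothNumbers_of_dvd m.2 (hk ▸ Dvd.intro_left _ rfl)⟩, Subtype.ext hk.symm⟩

lemma lcm_id_mem_smoothNumbers {E : Finset ℕ} {N : ℕ} (h : ∀ b ∈ E, 0 < b ∧ b ≤ N) :
    E.lcm id ∈ (N + 1).smoothNumbers := by
  rw [Nat.mem_smoothNumbers']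
  intro p hp hd
  have h1 : E.lcm id ∣ ∏ b ∈ E, b := Finset.lcm_dvd fun b hb => Finset.dvd_prod_of_mem _ hb
  obtain ⟨b, hb, hpb⟩ := (hp.prime.dvd_finsetProd_iff _).1 (hd.trans h1)
  exact Nat.lt_succ_of_le ((Nat.le_of_dvd (h b hb).1 hpb).trans (h b hb).2)

open Classical in
lemma hasSum_smooth_BFree {D : Finset ℕ} {N : ℕ} (h : ∀ b ∈ D, 0 < b ∧ b ≤ N) :
    HasSum (fun m : (N + 1).smoothNumbers =>
        if ((m : ℕ) : ℤ) ∈ BFreeSet (D : Set ℕ) then ((m : ℕ) : ℝ)⁻¹ else 0)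
      (smoothMass N * sieveDensity D) := by
  have h1 : HasSum (fun m : (N + 1).smoothNumbers => ∑ E ∈ D.powerset, (-1 : ℝ) ^ E.card *
      (if ((E.lcm id : ℕ) : ℤ) ∣ ((m : ℕ) : ℤ) then ((m : ℕ) : ℝ)⁻¹ else 0))
      (∑ E ∈ D.powerset, (-1 : ℝ) ^ E.card * (smoothMass N / ((E.lcm id : ℕ) : ℝ))) := by
    refine hasSum_sum fun E hE => (hasSum_smooth_dvd (lcm_id_mem_smoothNumbers fun b hb => ?_)).mul_left _
    exact h b (Finset.mem_powerset.1 hE hb)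
  have e : smoothMass N * sieveDensity D =
      ∑ E ∈ D.powerset, (-1 : ℝ) ^ E.card * (smoothMass N / ((E.lcm id : ℕ) : ℝ)) := by
    rw [sieveDensity, Finset.mul_sum]
    exact Finset.sum_congr rfl fun E _ => by ring
  rw [e]
  refine (congrArg (HasSum · _) (funext fun m => ?_)).mp h1
  have h2 := congrArg (fun x : ℝ => x * ((m : ℕ) : ℝ)⁻¹) (indicator_BFreeSet D (m : ℕ))
  simp only [ite_mul, one_mul, zero_mul, Finset.sum_mul, mul_assoc] at h2
  convert h2.symm

/-- The infimum of the densities of the finite sieves by subsets of `C`. -/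
noncomputable def sieveInf (C : Set ℕ) : ℝ := ⨅ D : {D : Finset ℕ // (D : Set ℕ) ⊆ C}, sieveDensity D

instance (C : Set ℕ) : Nonempty {D : Finset ℕ // (D : Set ℕ) ⊆ C} := ⟨⟨∅, by simp⟩⟩

lemma sieveInf_le {C : Set ℕ} (hC : ∀ b ∈ C, 0 < b) {D : Finset ℕ} (hD : (D : Set ℕ) ⊆ C) :
    sieveInf C ≤ sieveDensity D :=
  ciInf_le ⟨0, by rintro _ ⟨D, rfl⟩; exact sieveDensity_nonneg fun b hb => hC b (D.2 hb)⟩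
    (⟨D, hD⟩ : {D : Finset ℕ // (D : Set ℕ) ⊆ C})

lemma sieveInf_nonneg {C : Set ℕ} (hC : ∀ b ∈ C, 0 < b) : 0 ≤ sieveInf C :=
  le_ciInf fun D => sieveDensity_nonneg fun b hb => hC b (D.2 hb)

lemma exists_sieveDensity_lt {C : Set ℕ} {x : ℝ} (h : sieveInf C < x) :
    ∃ D : Finset ℕ, (D : Set ℕ) ⊆ C ∧ sieveDensity D < x := by
  obtain ⟨D, hD⟩ := exists_lt_of_ciInf_lt h
  exact ⟨D, D.2, hD⟩

open Classical in
lemma logSum_eq_sum_ite (A : Set ℤ) (N : ℕ) :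
    logSum A N = ∑ m ∈ Finset.Icc 1 N, if (m : ℤ) ∈ A then (m : ℝ)⁻¹ else 0 := by
  simp only [logSum, one_div]

lemma logSum_BFree_diff_le {D D' : Finset ℕ} (hDD : D ⊆ D') {N : ℕ} (h : ∀ b ∈ D', 0 < b ∧ b ≤ N) :
    logSum (BFreeSet (D : Set ℕ) \ BFreeSet (D' : Set ℕ)) N ≤
      smoothMass N * (sieveDensity D - sieveDensity D') := by
  classical
  have hsub := (hasSum_smooth_BFree fun b hb => h b (hDD hb)).sub (hasSum_smooth_BFree h)
  rw [← mul_sub] at hsub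
  have hterm : ∀ m : ℕ, (if (m : ℤ) ∈ BFreeSet (D : Set ℕ) \ BFreeSet (D' : Set ℕ) then (m : ℝ)⁻¹ else 0) =
      (if (m : ℤ) ∈ BFreeSet (D : Set ℕ) then (m : ℝ)⁻¹ else 0) -
      (if (m : ℤ) ∈ BFreeSet (D' : Set ℕ) then (m : ℝ)⁻¹ else 0) := by
    intro m
    have h3 : (m : ℤ) ∈ BFreeSet (D' : Set ℕ) → (m : ℤ) ∈ BFreeSet (D : Set ℕ) :=
      fun h => BFreeSet_anti (by exact_mod_cast hDD) h
    by_cases h1 : (m : ℤ) ∈ BFreeSet (D' : Set ℕ)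
    · simp [h1, h3 h1]
    · by_cases h2 : (m : ℤ) ∈ BFreeSet (D : Set ℕ) <;> simp [h1, h2]
  have hsub' : HasSum ((fun m : ℕ => if (m : ℤ) ∈ BFreeSet (D : Set ℕ) \ BFreeSet (D' : Set ℕ)
      then (m : ℝ)⁻¹ else 0) ∘ ((↑) : (N + 1).smoothNumbers → ℕ))
      (smoothMass N * (sieveDensity D - sieveDensity D')) := by
    refine (congrArg (HasSum · _) (funext fun m => ?_)).mp hsub
    exact (hterm m).symm
  have hnn : ∀ m : ℕ, (0 : ℝ) ≤ if (m : ℤ) ∈ BFreeSet (D : Set ℕ) \ BFreeSet (D' : Set ℕ)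
      then (m : ℝ)⁻¹ else 0 := fun m => by
    have : (0 : ℝ) ≤ (m : ℝ)⁻¹ := by positivity
    split_ifs <;> simp [this]
  have hle := sum_le_hasSum (Finset.Icc 1 N) (fun m _ => indicator_nonneg (fun m _ => hnn m) m)
    (hasSum_subtype_iff_indicator.1 hsub')
  rw [logSum_eq_sum_ite]
  refine le_trans (le_of_eq (Finset.sum_congr rfl fun m hm => ?_)) hle
  rw [Finset.mem_Icc] at hm
  rw [indicator_of_mem (Nat.mem_smoothNumbers_of_lt hm.1 (Nat.lt_succ_of_le hm.2))]
  congr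

lemma logSum_diff_le {C : Set ℕ} (hC : ∀ b ∈ C, 0 < b) {D : Finset ℕ} (hD : (D : Set ℕ) ⊆ C)
    {N : ℕ} (hN : ∀ b ∈ D, b ≤ N) :
    logSum (BFreeSet (D : Set ℕ) \ BFreeSet C) N ≤ smoothMass N * (sieveDensity D - sieveInf C) := by
  obtain ⟨D', hD'⟩ : ∃ D' : Finset ℕ, ∀ b, b ∈ D' ↔ b ∈ C ∧ b ≤ N :=
    ⟨((Set.finite_Iic N).inter_of_right C).toFinset, by simp⟩
  have hle := logSum_BFree_diff_le (D := D) (D' := D') (N := N)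
    (fun b hb => (hD' b).2 ⟨hD hb, hN b hb⟩) fun b hb => ⟨hC b ((hD' b).1 hb).1, ((hD' b).1 hb).2⟩
  have hZ : 0 ≤ smoothMass N := (hasSum_smooth_inv N).nonneg fun m => by positivity
  refine le_trans ?_ (hle.trans (mul_le_mul_of_nonneg_left
    (sub_le_sub_left (sieveInf_le hC fun b hb => ((hD' b).1 hb).1) _) hZ))
  refine logSum_mono fun n hn hnN hmem => ⟨hmem.1, fun hfree => hmem.2 fun b hb hd => ?_⟩
  have hbn : b ≤ n := Nat.le_of_dvd hn (Int.natCast_dvd_natCast.1 hd)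
  exact hfree b ((hD' b).2 ⟨hb, hbn.trans hnN⟩) hd

/-- The Davenport-Erdős estimate: a finite part of `C` sieves out all but a small logarithmic
proportion of the multiples of `C`. -/
lemma exists_logSum_diff_le {C : Set ℕ} (hC : ∀ b ∈ C, 0 < b) {ε : ℝ} (hε : 0 < ε) :
    ∃ D : Finset ℕ, (D : Set ℕ) ⊆ C ∧ sieveDensity D < sieveInf C + ε ∧
      ∀ᶠ N : ℕ in atTop, logSum (BFreeSet (D : Set ℕ) \ BFreeSet C) N ≤ ε * Real.log N := by
  obtain ⟨K, hK, hKN⟩ := exists_smoothMass_le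
  obtain ⟨D, hD, hlt⟩ := exists_sieveDensity_lt (C := C) (x := sieveInf C + min ε (ε / K))
    (by linarith [lt_min hε (div_pos hε hK)])
  refine ⟨D, hD, hlt.trans_le (by linarith [min_le_left ε (ε / K)]), ?_⟩
  filter_upwards [hKN, eventually_ge_atTop (D.sup id)] with N h1 h2
  have h3 : 0 ≤ sieveDensity D - sieveInf C := sub_nonneg.2 (sieveInf_le hC hD)
  have h4 : sieveDensity D - sieveInf C ≤ ε / K := by linarith [min_le_right ε (ε / K)]
  have h5 : 0 ≤ Real.log N := Real.log_natCast_nonneg N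
  calc _ ≤ smoothMass N * (sieveDensity D - sieveInf C) :=
        logSum_diff_le hC hD fun b hb => (Finset.le_sup (f := id) hb).trans h2
    _ ≤ K * Real.log N * (ε / K) := by
        exact mul_le_mul h1 h4 h3 (by positivity)
    _ = ε * Real.log N := by field_simp

/-- The Davenport-Erdős theorem. -/
theorem hasLogDensity_BFreeSet {C : Set ℕ} (hC : ∀ b ∈ C, 0 < b) :
    HasLogDensity (BFreeSet C) (sieveInf C) := by
  rw [hasLogDensity_iff, tendsto_order]
  constructor
  · intro x hx
    obtain ⟨D, hD, -, h2⟩ := exists_logSum_diff_le hC (half_pos (sub_pos.2 hx))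
    have h3 := (hasLogDensity_iff _ _).1 (hasLogDensity_BFree_finset fun b hb => hC b (hD hb))
    have h4 := sieveInf_le hC hD
    filter_upwards [h2, h3.eventually_const_lt (show x + (sieveInf C - x) / 2 < sieveDensity D by linarith),
      eventually_ge_atTop 2] with N h5 h6 h7
    have hlog : 0 < Real.log N := Real.log_pos (by exact_mod_cast h7)
    have h8 := logSum_union_le (BFreeSet C) (BFreeSet (D : Set ℕ) \ BFreeSet C) N
    rw [union_sdiff_cancel (BFreeSet_anti hD)] at h8
    rw [inv_mul_eq_div, lt_div_iff₀ hlog] at *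
    linarith
  · intro x hx
    obtain ⟨D, hD, h1⟩ := exists_sieveDensity_lt hx
    have h3 := (hasLogDensity_iff _ _).1 (hasLogDensity_BFree_finset fun b hb => hC b (hD hb))
    filter_upwards [h3.eventually_lt_const h1] with N h5
    refine lt_of_le_of_lt ?_ h5
    exact mul_le_mul_of_nonneg_left (logSum_mono fun n _ _ hn => BFreeSet_anti hD hn)
      (inv_nonneg.2 (Real.log_natCast_nonneg N))

open Classical in
lemma logSum_eq_sum_filter (A : Set ℤ) (N : ℕ) :
    logSum A N = ∑ m ∈ (Finset.Icc 1 N).filter (fun n : ℕ => (n : ℤ) ∈ A), (m : ℝ)⁻¹ := by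
  rw [logSum_eq_sum_ite, Finset.sum_filter]

lemma logSum_multiples_le {A A' : Set ℤ} {a : ℕ} (ha : 0 < a) (h : ∀ n : ℤ, a * n ∈ A → n ∈ A') (N : ℕ) :
    logSum (A ∩ {n | (a : ℤ) ∣ n}) N ≤ (a : ℝ)⁻¹ * logSum A' N := by
  classical
  rw [logSum_eq_sum_filter, logSum_eq_sum_filter, Finset.mul_sum]
  have hinj : ∀ x ∈ (Finset.Icc 1 N).filter (fun n : ℕ => (n : ℤ) ∈ A'),
      ∀ y ∈ (Finset.Icc 1 N).filter (fun n : ℕ => (n : ℤ) ∈ A'), a * x = a * y → x = y :=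
    fun x _ y _ hxy => Nat.eq_of_mul_eq_mul_left ha hxy
  have e : ∑ n ∈ (Finset.Icc 1 N).filter (fun n : ℕ => (n : ℤ) ∈ A'), (a : ℝ)⁻¹ * (n : ℝ)⁻¹ =
      ∑ n ∈ ((Finset.Icc 1 N).filter (fun n : ℕ => (n : ℤ) ∈ A')).image (a * ·), (n : ℝ)⁻¹ := by
    rw [Finset.sum_image hinj]
    exact Finset.sum_congr rfl fun n _ => by push_cast; rw [mul_inv]
  rw [e]
  refine Finset.sum_le_sum_of_subset_of_nonneg (fun n hn => ?_) fun _ _ _ => by positivity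
  simp only [Finset.mem_filter, Finset.mem_Icc, mem_inter_iff, mem_ofPred_eq] at hn
  obtain ⟨⟨h1, h2⟩, h3, h4⟩ := hn
  obtain ⟨k, rfl⟩ := Int.natCast_dvd_natCast.1 h4
  have hk : 0 < k := Nat.pos_of_mul_pos_left h1
  simp only [Finset.mem_image, Finset.mem_filter, Finset.mem_Icc]
  exact ⟨k, ⟨⟨hk, (Nat.le_mul_of_pos_left k ha).trans h2⟩, h k (by exact_mod_cast h3)⟩, rfl⟩

lemma logSum_add_compl (A : Set ℤ) (N : ℕ) : logSum A N + logSum Aᶜ N = logSum univ N := by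
  classical
  unfold logSum
  rw [← Finset.sum_add_distrib]
  refine Finset.sum_congr rfl fun n _ => ?_
  by_cases h : (n : ℤ) ∈ A <;> simp [h]

lemma HasLogDensity.compl {A : Set ℤ} {d : ℝ} (h : HasLogDensity A d) : HasLogDensity Aᶜ (1 - d) := by
  rw [hasLogDensity_iff] at *
  have h1 := ((hasLogDensity_iff _ _).1 hasLogDensity_univ).sub h
  refine h1.congr fun N => ?_
  rw [← logSum_add_compl A N]
  ring

lemma HasLogDensity.eventually_logSum_le {A : Set ℤ} {d x : ℝ} (h : HasLogDensity A d) (hx : d < x) :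
    ∀ᶠ N : ℕ in atTop, logSum A N ≤ x * Real.log N := by
  rw [hasLogDensity_iff] at h
  filter_upwards [h.eventually_lt_const hx, eventually_ge_atTop 2] with N h1 h2
  have hlog : 0 < Real.log N := Real.log_pos (by exact_mod_cast h2)
  rw [inv_mul_eq_div, div_lt_iff₀ hlog] at h1
  exact h1.le

lemma sieveDensity_insert_ge {D : Finset ℕ} (hD : ∀ b ∈ D, 0 < b) {a : ℕ} (ha : 0 < a) :
    (1 - (a : ℝ)⁻¹) * sieveDensity D ≤ sieveDensity (insert a D) := by
  have h1 := (hasLogDensity_iff _ _).1 (hasLogDensity_BFree_finset hD)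
  have h2 := (hasLogDensity_iff _ _).1 (hasLogDensity_BFree_finset (D := insert a D)
    (by simpa using ⟨ha, hD⟩))
  refine le_of_tendsto_of_tendsto' (h1.const_mul _) h2 fun N => ?_
  have h3 : logSum (BFreeSet (D : Set ℕ)) N ≤ logSum (BFreeSet ((insert a D : Finset ℕ) : Set ℕ)) N +
      (a : ℝ)⁻¹ * logSum (BFreeSet (D : Set ℕ)) N := by
    refine le_trans ?_ (add_le_add_right (logSum_multiples_le (A := BFreeSet (D : Set ℕ))
      (A' := BFreeSet (D : Set ℕ)) ha
      (fun n hn b hb hd => hn b hb (hd.mul_left _)) N) _)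
    refine le_trans (logSum_mono fun n _ _ hn => ?_) (logSum_union_le _ _ N)
    by_cases h : (a : ℤ) ∣ n
    · exact Or.inr ⟨hn, h⟩
    · refine Or.inl fun b hb => ?_
      rw [Finset.coe_insert, mem_insert_iff] at hb
      rcases hb with rfl | hb
      exacts [h, hn b hb]
  have h4 : 0 ≤ (Real.log N)⁻¹ := inv_nonneg.2 (Real.log_natCast_nonneg N)
  nlinarith

/-- The quotients `b / d` of the elements `b` of `B` with `gcd b g = d`. -/
def quotSet (B : Set ℕ) (g d : ℕ) : Set ℕ := {a | d * a ∈ B ∧ Nat.gcd (d * a) g = d}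

lemma two_le_of_mem_quotSet {B : Set ℕ} (hB : ∀ b ∈ B, 2 ≤ b) {g d a : ℕ} (hg : (g : ℤ) ∈ BFreeSet B)
    (ha : a ∈ quotSet B g d) : 2 ≤ a := by
  obtain ⟨h1, h2⟩ := ha
  have h3 := hB _ h1
  rcases Nat.lt_or_ge a 2 with h | h
  · interval_cases a
    · omega
    · rw [mul_one] at h1 h2
      exact absurd (Int.natCast_dvd_natCast.2 (h2 ▸ Nat.gcd_dvd_right d g)) (hg d h1)
  · exact h

lemma sieveInf_empty : sieveInf ∅ = 1 := by
  refine le_antisymm ?_ (le_ciInf fun D => ?_)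
  · simpa [sieveDensity] using sieveInf_le (C := ∅) (D := ∅) (by simp) (by simp)
  · have : D.1 = ∅ := Finset.coe_eq_empty.1 (subset_empty_iff.1 D.2)
    simp [this, sieveDensity]

lemma sieveInf_diff_singleton_eq_zero {C : Set ℕ} (hC : ∀ b ∈ C, 2 ≤ b) (h : sieveInf C = 0) {a : ℕ}
    (ha : a ∈ C) : sieveInf (C \ {a}) = 0 := by
  have hC0 : ∀ b ∈ C, 0 < b := fun b hb => by have := hC b hb; omega
  refine le_antisymm (le_of_forall_pos_le_add fun ε hε => ?_) (sieveInf_nonneg fun b hb => hC0 b hb.1)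
  obtain ⟨D, hD, hlt⟩ := exists_sieveDensity_lt (C := C) (x := ε / 2) (by rw [h]; positivity)
  have h1 := sieveDensity_insert_ge (D := D.erase a) (fun b hb => hC0 b (hD (Finset.mem_of_mem_erase hb)))
    (hC0 a ha)
  have h2 : sieveDensity (insert a (D.erase a)) ≤ sieveDensity D :=
    sieveDensity_anti (fun b hb => by
      rcases Finset.mem_insert.1 hb with rfl | hb
      exacts [hC0 b ha, hC0 b (hD (Finset.mem_of_mem_erase hb))]) (Finset.subset_insert_iff.2 subset_rfl)
  have h3 : sieveInf (C \ {a}) ≤ sieveDensity (D.erase a) :=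
    sieveInf_le (fun b hb => hC0 b hb.1) (by rw [Finset.coe_erase]; exact sdiff_subset_sdiff_left hD)
  have h4 : 0 ≤ sieveDensity (D.erase a) :=
    sieveDensity_nonneg fun b hb => hC0 b (hD (Finset.mem_of_mem_erase hb))
  have h5 : (a : ℝ)⁻¹ ≤ 1 / 2 := by
    rw [← one_div]
    exact one_div_le_one_div_of_le two_pos (by exact_mod_cast hC a ha)
  nlinarith

/-- In a taut set, no quotient set sieves out everything. -/
lemma sieveInf_quotSet_pos {B : Set ℕ} (hB : ∀ b ∈ B, 2 ≤ b) (hT : IsTaut B) {g d : ℕ}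
    (hd : 0 < d) (hg : (g : ℤ) ∈ BFreeSet B) : 0 < sieveInf (quotSet B g d) := by
  have hA : ∀ a ∈ quotSet B g d, 2 ≤ a := fun a ha => two_le_of_mem_quotSet hB hg ha
  have hB0 : ∀ b ∈ B, 0 < b := fun b hb => by have := hB b hb; omega
  have hA0 : ∀ a ∈ quotSet B g d, 0 < a := fun b hb => by have := hA b hb; omega
  by_contra hcon
  have h0 : sieveInf (quotSet B g d) = 0 := le_antisymm (not_lt.1 hcon) (sieveInf_nonneg hA0)
  obtain ⟨a, ha⟩ : (quotSet B g d).Nonempty := by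
    by_contra hne
    rw [not_nonempty_iff_eq_empty] at hne
    rw [hne, sieveInf_empty] at h0
    exact one_ne_zero h0
  have h1 := hasLogDensity_BFreeSet (C := quotSet B g d \ {a}) fun b hb => hA0 b hb.1
  rw [sieveInf_diff_singleton_eq_zero hA h0 ha] at h1
  have h2 := hasLogDensity_BFreeSet hB0
  have h3 := hasLogDensity_BFreeSet (C := B \ {d * a}) fun b hb => hB0 b hb.1
  have h4 := hT (d * a) ha.1 _ _ h2 h3
  rw [hasLogDensity_iff] at h1 h2 h3
  have h5 := h2.add (h1.const_mul (d : ℝ)⁻¹)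
  rw [mul_zero, add_zero] at h5
  refine absurd (le_of_tendsto_of_tendsto' h3 h5 fun N => ?_) (not_le.2 h4)
  have h6 : logSum (BFreeSet (B \ {d * a})) N ≤
      logSum (BFreeSet B) N + (d : ℝ)⁻¹ * logSum (BFreeSet (quotSet B g d \ {a})) N := by
    refine le_trans ?_ (add_le_add_right (logSum_multiples_le (A := BFreeSet (B \ {d * a}))
      (A' := BFreeSet (quotSet B g d \ {a})) hd
      (fun n hn c hc hcd => hn (d * c) ⟨hc.1.1, fun h => hc.2 ?_⟩ ?_) N) _)
    · refine le_trans (logSum_mono fun n _ _ hn => ?_) (logSum_union_le _ _ N)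
      by_cases h : ((d * a : ℕ) : ℤ) ∣ n
      · exact Or.inr ⟨hn, (Dvd.intro _ (by push_cast; rfl)).trans h⟩
      · refine Or.inl fun b hb => ?_
        by_cases hba : b = d * a
        exacts [hba ▸ h, hn b ⟨hb, hba⟩]
    · exact Nat.eq_of_mul_eq_mul_left hd h
    · push_cast
      exact mul_dvd_mul_left _ hcd
  calc _ ≤ (Real.log N)⁻¹ * (logSum (BFreeSet B) N + (d : ℝ)⁻¹ * logSum (BFreeSet (quotSet B g d \ {a})) N) :=
        mul_le_mul_of_nonneg_left h6 (inv_nonneg.2 (Real.log_natCast_nonneg N))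
    _ = _ := by ring

/-- If `C` does not sieve out everything, then the part of `C` coprime to a suitable modulus sieves
out arbitrarily little. -/
lemma exists_forall_coprime_sieveDensity_ge {C : Set ℕ} (hC : ∀ b ∈ C, 2 ≤ b) (h : 0 < sieveInf C)
    {ε : ℝ} (hε : 0 < ε) :
    ∃ M : ℕ, 0 < M ∧ ∀ D : Finset ℕ, (D : Set ℕ) ⊆ C → (∀ b ∈ D, Nat.Coprime b M) →
      1 - ε ≤ sieveDensity D := by
  have hC0 : ∀ b ∈ C, 0 < b := fun b hb => by have := hC b hb; omega
  obtain ⟨D₀, hD₀, hlt⟩ := exists_sieveDensity_lt (C := C) (x := sieveInf C * (1 + ε)) (by nlinarith)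
  refine ⟨D₀.lcm id, lcm_id_pos fun b hb => hC0 b (hD₀ hb), fun D hD hcop => ?_⟩
  have hdisj : Disjoint D₀ D := Finset.disjoint_left.2 fun b h1 h2 => by
    have h3 : b = 1 := Nat.eq_one_of_dvd_coprimes (hcop b h2) dvd_rfl (Finset.dvd_lcm (f := id) h1)
    have := hC b (hD h2)
    omega
  have h1 := sieveDensity_union hdisj hcop
  have h2 : sieveInf C ≤ sieveDensity (D₀ ∪ D) :=
    sieveInf_le hC0 (by rw [Finset.coe_union]; exact union_subset hD₀ hD)
  have h3 : 0 ≤ sieveDensity D := sieveDensity_nonneg fun b hb => hC0 b (hD hb)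
  by_contra hcon
  rw [not_le] at hcon
  have h4 : sieveInf C ≤ sieveInf C * (1 + ε) * (1 - ε) := by
    calc _ ≤ sieveDensity D₀ * sieveDensity D := h1 ▸ h2
      _ ≤ sieveInf C * (1 + ε) * (1 - ε) :=
          mul_le_mul hlt.le hcon.le h3 (by positivity)
  nlinarith [mul_pos h (mul_pos hε hε)]

/-- If `n + L * s` is a multiple of `b`, then for some divisor `d` of `gcd n L`, the reduced
progression meets the multiples of a quotient coprime to its modulus. -/
lemma exists_quotient_dvd {g b M : ℕ} {r s : ℤ} (hg : 0 < g)
    (hcop : IsCoprime r (M : ℤ)) (h : (b : ℤ) ∣ g * (r + M * s)) :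
    ∃ d ∈ g.divisors, ∃ a : ℕ, d * a = b ∧ Nat.gcd b g = d ∧ Nat.Coprime a M ∧ (a : ℤ) ∣ r + M * s := by
  obtain ⟨a, ha⟩ := Nat.gcd_dvd_left b g
  obtain ⟨g', hg'⟩ := Nat.gcd_dvd_right b g
  have hd : 0 < Nat.gcd b g := Nat.gcd_pos_of_pos_right _ hg
  have hcop' : Nat.Coprime a g' := by
    have := Nat.gcd_mul_left (Nat.gcd b g) a g'
    rw [← ha, ← hg'] at this
    exact Nat.eq_of_mul_eq_mul_left hd (by rw [← this, mul_one])
  have hdvd : (a : ℤ) ∣ r + M * s := by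
    have h1 : ((Nat.gcd b g : ℕ) : ℤ) * a ∣ ((Nat.gcd b g : ℕ) : ℤ) * (g' * (r + M * s)) := by
      rw [← mul_assoc]
      have e1 : ((Nat.gcd b g : ℕ) : ℤ) * a = b := by exact_mod_cast ha.symm
      have e2 : ((Nat.gcd b g : ℕ) : ℤ) * g' = g := by exact_mod_cast hg'.symm
      rw [e1, e2]
      exact h
    have h2 := Int.dvd_of_mul_dvd_mul_left (by exact_mod_cast hd.ne') h1
    exact (Nat.isCoprime_iff_coprime.2 hcop').dvd_of_dvd_mul_left h2
  refine ⟨_, Nat.mem_divisors.2 ⟨Nat.gcd_dvd_right b g, hg.ne'⟩, a, ha.symm, rfl, ?_, hdvd⟩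
  have h1 : (((Nat.gcd a M) : ℕ) : ℤ) ∣ (a : ℤ) := Int.natCast_dvd_natCast.2 (Nat.gcd_dvd_left a M)
  have h2 : (((Nat.gcd a M) : ℕ) : ℤ) ∣ (M : ℤ) := Int.natCast_dvd_natCast.2 (Nat.gcd_dvd_right a M)
  have h3 : (((Nat.gcd a M) : ℕ) : ℤ) ∣ r := by
    have := dvd_sub (h1.trans hdvd) (h2.mul_right s)
    rwa [add_sub_cancel_right] at this
  have h4 := hcop.isUnit_of_dvd' h3 h2
  rw [Int.isUnit_iff_natAbs_eq, Int.natAbs_natCast] at h4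
  exact h4

/-- Along a progression with `B`-free gcd and sufficiently divisible modulus, a finite part of `B`
sieves out arbitrarily little. -/
lemma exists_modulus_forall_logSum_le {B : Set ℕ} (hB : ∀ b ∈ B, 2 ≤ b) (hT : IsTaut B) {g : ℕ}
    (hg0 : 0 < g) (hg : (g : ℤ) ∈ BFreeSet B) {ε : ℝ} (hε : 0 < ε) :
    ∃ M : ℕ, 0 < M ∧ ∀ (r : ℤ) (L : ℕ), IsCoprime r (L : ℤ) → M ∣ L →
      ∀ D : Finset ℕ, (D : Set ℕ) ⊆ B →
        ∀ᶠ N : ℕ in atTop, logSum {s : ℤ | g * (r + L * s) ∉ BFreeSet (D : Set ℕ)} N ≤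
          ε * Real.log N := by
  classical
  set δ : ℝ := ε / (2 * g.divisors.card)
  have hcard : 0 < g.divisors.card := Finset.card_pos.2 ⟨1, Nat.one_mem_divisors.2 hg0.ne'⟩
  have hδ : 0 < δ := by positivity
  have hex : ∀ d ∈ g.divisors, ∃ M : ℕ, 0 < M ∧ ∀ D : Finset ℕ, (D : Set ℕ) ⊆ quotSet B g d →
      (∀ b ∈ D, Nat.Coprime b M) → 1 - δ ≤ sieveDensity D := fun d hd =>
    exists_forall_coprime_sieveDensity_ge (fun a ha => two_le_of_mem_quotSet hB hg ha)
      (sieveInf_quotSet_pos hB hT (Nat.pos_of_mem_divisors hd) hg) hδ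
  choose! M hM0 hM using hex
  refine ⟨∏ d ∈ g.divisors, M d, Finset.prod_pos hM0, fun r L hcop hML D hD => ?_⟩
  let Q : ℕ → Finset ℕ := fun d => (D.image (· / d)).filter
    fun a => d * a ∈ D ∧ Nat.gcd (d * a) g = d ∧ Nat.Coprime a L
  have hQsub : ∀ d, (Q d : Set ℕ) ⊆ quotSet B g d := fun d a ha => by
    have ha' := (Finset.mem_filter.1 ha).2
    exact ⟨hD ha'.1, ha'.2.1⟩
  have hQcop : ∀ d, ∀ a ∈ Q d, Nat.Coprime a L := fun d a ha => (Finset.mem_filter.1 ha).2.2.2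
  have hQpos : ∀ d, ∀ a ∈ Q d, 0 < a := fun d a ha => by
    have := two_le_of_mem_quotSet hB hg (hQsub d ha)
    omega
  have hbd : ∀ d ∈ g.divisors, ∀ᶠ N : ℕ in atTop,
      logSum {s : ℤ | r + L * s ∈ BFreeSet (Q d : Set ℕ)}ᶜ N ≤ 2 * δ * Real.log N := fun d hd => by
    refine (hasLogDensity_BFree_linear (hQpos d) (hQcop d) r).compl.eventually_logSum_le ?_
    have := hM d hd (Q d) (hQsub d) fun b hb => (hQcop d b hb).coprime_dvd_right
      ((Finset.dvd_prod_of_mem M hd).trans hML)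
    linarith
  filter_upwards [(eventually_all_finset _).2 hbd] with N hN
  calc _ ≤ logSum (⋃ d ∈ g.divisors, {s : ℤ | r + L * s ∈ BFreeSet (Q d : Set ℕ)}ᶜ) N := by
        refine logSum_mono fun s _ _ hs => ?_
        simp only [BFreeSet, mem_ofPred_eq, not_forall, not_not] at hs
        obtain ⟨b, hb, hbd⟩ := hs
        obtain ⟨d, hd, a, rfl, hgcd, hac, hdvd⟩ := exists_quotient_dvd hg0 hcop hbd
        refine mem_biUnion (x := d) hd fun hfree => hfree a ?_ hdvd
        have hd0 := Nat.pos_of_mem_divisors hd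
        exact Finset.mem_filter.2 ⟨Finset.mem_image.2 ⟨_, hb, Nat.mul_div_cancel_left a hd0⟩, hb, hgcd, hac⟩
    _ ≤ ∑ d ∈ g.divisors, 2 * δ * Real.log N :=
        (logSum_biUnion_le _ _ N).trans (Finset.sum_le_sum hN)
    _ = ε * Real.log N := by
        rw [Finset.sum_const, nsmul_eq_mul]
        simp only [δ]
        field_simp

lemma logSum_le_of_forall_le {A : Set ℤ} {K : ℕ} (h : ∀ n ∈ A, n ≤ K) (N : ℕ) : logSum A N ≤ K := by
  classical
  rw [logSum_eq_sum_filter]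
  calc _ ≤ ∑ n ∈ Finset.Icc 1 K, (1 : ℝ) := by
        refine (Finset.sum_le_sum (g := fun _ => (1 : ℝ)) fun n hn => ?_).trans
          (Finset.sum_le_sum_of_subset_of_nonneg (fun n hn => ?_) fun _ _ _ => zero_le_one)
        · have := (Finset.mem_Icc.1 (Finset.mem_filter.1 hn).1).1
          exact inv_le_one_of_one_le₀ (by exact_mod_cast this)
        · rw [Finset.mem_filter, Finset.mem_Icc] at hn
          exact Finset.mem_Icc.2 ⟨hn.1.1, by exact_mod_cast h _ hn.2⟩
    _ = K := by simp

lemma logSum_le_add_logSum_Ioi (A : Set ℤ) (K N : ℕ) : logSum A N ≤ K + logSum (A ∩ Ioi (K : ℤ)) N := by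
  refine le_trans (logSum_mono fun n _ _ hn => ?_) ((logSum_union_le (Iic (K : ℤ)) _ N).trans
    (add_le_add_left (logSum_le_of_forall_le (fun n hn => hn) N) _))
  rcases le_or_gt (n : ℤ) K with h | h
  exacts [Or.inl h, Or.inr ⟨hn, h⟩]

lemma logSum_linear_le (A : Set ℤ) (n : ℤ) {L : ℕ} (hL : 0 < L) (N : ℕ) :
    logSum {s : ℤ | n + L * s ∈ A} N ≤ n.natAbs + 2 * L * logSum A (2 * L * N) := by
  classical
  refine (logSum_le_add_logSum_Ioi _ n.natAbs N).trans (add_le_add_right ?_ _)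
  have hpos : ∀ s : ℕ, (n.natAbs : ℤ) < s → 0 < n + L * s ∧ n + L * s ≤ 2 * L * s := by
    intro s hs
    have h1 : (s : ℤ) ≤ L * s := le_mul_of_one_le_left (by positivity) (by exact_mod_cast hL)
    have : (2 : ℤ) * L * s = L * s + L * s := by ring
    omega
  set f : ℕ → ℕ := fun s => (n + L * s).toNat
  obtain ⟨A₁, hA₁⟩ : ∃ A₁, A₁ = {s : ℤ | n + L * s ∈ A} ∩ Ioi (n.natAbs : ℤ) := ⟨_, rfl⟩
  rw [← hA₁, logSum_eq_sum_filter, logSum_eq_sum_filter, Finset.mul_sum]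
  set F := (Finset.Icc 1 N).filter fun s : ℕ => (s : ℤ) ∈ A₁
  have hF : ∀ s ∈ F, (1 ≤ s ∧ s ≤ N) ∧ n + L * s ∈ A ∧ (n.natAbs : ℤ) < s := fun s hs => by
    rw [Finset.mem_filter, Finset.mem_Icc, hA₁] at hs
    exact ⟨hs.1, hs.2.1, hs.2.2⟩
  have hf : ∀ s ∈ F, ((f s : ℕ) : ℤ) = n + L * s := fun s hs =>
    Int.toNat_of_nonneg (hpos s (hF s hs).2.2).1.le
  have hinj : Set.InjOn f F := fun s hs t ht hst => by
    have h1 : n + (L : ℤ) * s = n + L * t := by rw [← hf s hs, ← hf t ht, hst]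
    have h2 := mul_left_cancel₀ (by exact_mod_cast hL.ne') (add_left_cancel h1)
    exact_mod_cast h2
  calc ∑ s ∈ F, (s : ℝ)⁻¹ ≤ ∑ s ∈ F, 2 * L * ((f s : ℕ) : ℝ)⁻¹ := by
        refine Finset.sum_le_sum fun s hs => ?_
        have h1 := hF s hs
        have h2 := hpos s h1.2.2
        rw [← hf s hs] at h2
        have h3 : (0 : ℝ) < f s := by exact_mod_cast h2.1
        have h4 : (f s : ℝ) ≤ 2 * L * s := by exact_mod_cast h2.2
        have h5 : (0 : ℝ) < s := by exact_mod_cast h1.1.1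
        rw [← div_eq_mul_inv, inv_eq_one_div, div_le_div_iff₀ h5 h3]
        linarith
    _ = ∑ m ∈ F.image f, 2 * L * (m : ℝ)⁻¹ :=
        (Finset.sum_image (f := fun m : ℕ => 2 * (L : ℝ) * (m : ℝ)⁻¹) hinj).symm
    _ ≤ _ := by
        refine Finset.sum_le_sum_of_subset_of_nonneg (fun m hm => ?_) fun _ _ _ => by positivity
        obtain ⟨s, hs, rfl⟩ := Finset.mem_image.1 hm
        have h1 := hF s hs
        have h2 := hpos s h1.2.2
        rw [Finset.mem_filter, Finset.mem_Icc, hf s hs]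
        rw [← hf s hs] at h2
        exact ⟨⟨by exact_mod_cast h2.1, le_trans (by exact_mod_cast h2.2) (Nat.mul_le_mul_left _ h1.1.2)⟩,
          h1.2.1⟩

/-- If along each progression `n + L * s`, `n ∈ Y`, finite parts of `B` sieve out a small proportion,
then infinitely often all these progressions are simultaneously `B`-free. -/
lemma infinite_setOf_forall_linear_mem {B : Set ℕ} (hB : ∀ b ∈ B, 2 ≤ b) (Y : Finset ℤ) {L : ℕ}
    (hL : 0 < L) (h : ∀ n ∈ Y, ∀ D : Finset ℕ, (D : Set ℕ) ⊆ B → ∀ᶠ N : ℕ in atTop,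
      logSum {s : ℤ | n + L * s ∉ BFreeSet (D : Set ℕ)} N ≤ (3 * ((Y.card : ℝ) + 1))⁻¹ * Real.log N) :
    {s : ℕ | ∀ n ∈ Y, n + (L : ℤ) * s ∈ BFreeSet B}.Infinite := by
  intro hfin
  obtain ⟨K, hK⟩ := hfin.bddAbove
  set δ : ℝ := (3 * ((Y.card : ℝ) + 1))⁻¹
  have hδ : 0 < δ := by positivity
  have hL' : (0 : ℝ) < L := by exact_mod_cast hL
  obtain ⟨D, hD, -, hDB⟩ := exists_logSum_diff_le (C := B) (fun b hb => by have := hB b hb; omega)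
    (show 0 < δ / (4 * L) by positivity)
  have htend : Tendsto (fun N : ℕ => 2 * L * N) atTop atTop :=
    tendsto_id.const_mul_atTop' (by positivity)
  have hcover : ∀ N : ℕ, Real.log N ≤ K + ∑ n ∈ Y,
      (logSum {s : ℤ | n + L * s ∉ BFreeSet (D : Set ℕ)} N + (n.natAbs +
        2 * L * logSum (BFreeSet (D : Set ℕ) \ BFreeSet B) (2 * L * N))) := by
    intro N
    have h1 : Real.log N ≤ logSum univ N := by
      rw [logSum_univ]
      rcases Nat.eq_zero_or_pos N with rfl | hN
      · simp
      · refine (Real.log_le_log (by exact_mod_cast hN) ?_).trans (log_add_one_le_harmonic N)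
        push_cast
        linarith
    refine h1.trans ((logSum_le_add_logSum_Ioi _ K N).trans (add_le_add_right ?_ _))
    refine le_trans (logSum_mono (A' := ⋃ n ∈ Y, ({s : ℤ | n + L * s ∉ BFreeSet (D : Set ℕ)} ∪
      {s : ℤ | n + L * s ∈ BFreeSet (D : Set ℕ) \ BFreeSet B})) fun s _ _ hs => ?_) 
      ((logSum_biUnion_le _ _ N).trans (Finset.sum_le_sum fun n _ => (logSum_union_le _ _ N).trans
        (add_le_add_right (logSum_linear_le _ n hL N) _)))
    have h2 : ¬ ∀ n ∈ Y, n + (L : ℤ) * s ∈ BFreeSet B := fun hall =>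
      absurd (hK hall) (not_le.2 (Int.ofNat_lt.1 hs.2))
    push Not at h2
    obtain ⟨n, hn, hnB⟩ := h2
    refine mem_biUnion (x := n) hn ?_
    by_cases hnD : n + (L : ℤ) * s ∈ BFreeSet (D : Set ℕ)
    exacts [Or.inr ⟨hnD, hnB⟩, Or.inl hnD]
  obtain ⟨N, h1, h2, h3, h4⟩ := (((eventually_all_finset Y).2 fun n hn => h n hn D hD).and
    ((htend.eventually hDB).and ((eventually_ge_atTop (2 * L)).and
    (tendsto_log_natCast.eventually_gt_atTop (3 * (K + ∑ n ∈ Y, (n.natAbs : ℝ))))))).exists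
  have hNpos : (0 : ℝ) < N := by exact_mod_cast (show 0 < N by omega)
  have h5 : Real.log ((2 * L * N : ℕ) : ℝ) ≤ 2 * Real.log N := by
    rw [Nat.cast_mul, Real.log_mul (by positivity) hNpos.ne']
    have h6 : Real.log ((2 * L : ℕ) : ℝ) ≤ Real.log N :=
      Real.log_le_log (by positivity) (by exact_mod_cast h3)
    linarith
  have h6 : ∀ n ∈ Y, logSum {s : ℤ | n + L * s ∉ BFreeSet (D : Set ℕ)} N + (n.natAbs +
        2 * L * logSum (BFreeSet (D : Set ℕ) \ BFreeSet B) (2 * L * N)) ≤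
      2 * δ * Real.log N + n.natAbs := by
    intro n hn
    have h7 : 2 * L * logSum (BFreeSet (D : Set ℕ) \ BFreeSet B) (2 * L * N) ≤ δ * Real.log N := by
      calc _ ≤ 2 * L * (δ / (4 * L) * (2 * Real.log N)) := by
            gcongr
            exact h2.trans (mul_le_mul_of_nonneg_left h5 (by positivity))
        _ = δ * Real.log N := by field_simp; ring
    linarith [h1 n hn]
  have h8 := (hcover N).trans (add_le_add_right (Finset.sum_le_sum h6) _)
  rw [Finset.sum_add_distrib, Finset.sum_const, nsmul_eq_mul] at h8
  have h9 : (Y.card : ℝ) * δ ≤ 1 / 3 := by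
    simp only [δ]
    rw [mul_inv_le_iff₀ (by positivity)]
    linarith
  have h10 : 0 ≤ Real.log N := Real.log_natCast_nonneg N
  nlinarith

lemma natAbs_mem_BFreeSet {B : Set ℕ} {n : ℤ} : (n.natAbs : ℤ) ∈ BFreeSet B ↔ n ∈ BFreeSet B := by
  simp only [BFreeSet, mem_ofPred_eq, Int.dvd_natAbs]

/-- A residue class modulo `b ∈ B` other than zero contains infinitely many `B`-free integers. -/
lemma infinite_setOf_mem_BFreeSet_dvd_sub {B : Set ℕ} (hB : ∀ b ∈ B, 2 ≤ b) (hP : Primitive B)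
    (hT : IsTaut B) {b : ℕ} (hb : b ∈ B) {r : ℤ} (hr : ¬ (b : ℤ) ∣ r) :
    {n : ℕ | (n : ℤ) ∈ BFreeSet B ∧ (b : ℤ) ∣ n - r}.Infinite := by
  have hb0 : 0 < b := by have := hB b hb; omega
  have hg0 : 0 < Int.gcd r b := Int.gcd_pos_of_ne_zero_right _ (by exact_mod_cast hb0.ne')
  set g := Int.gcd r b
  have hg : (g : ℤ) ∈ BFreeSet B := fun c hc hcg => by
    have h1 : (c : ℤ) ∣ b := hcg.trans (Int.gcd_dvd_right _ _)
    obtain rfl := hP c hc b hb (Int.natCast_dvd_natCast.1 h1)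
    exact hr (hcg.trans (Int.gcd_dvd_left _ _))
  obtain ⟨r₁, hr₁⟩ : (g : ℤ) ∣ r := Int.gcd_dvd_left _ _
  obtain ⟨b₁, hb₁⟩ : g ∣ b := Int.natCast_dvd_natCast.1 (Int.gcd_dvd_right r b)
  have hb₁0 : 0 < b₁ := Nat.pos_of_ne_zero fun h => by simp [h] at hb₁; omega
  have hcop : IsCoprime r₁ (b₁ : ℤ) := by
    rw [Int.isCoprime_iff_gcd_eq_one]
    have h1 : Int.gcd r b = g * Int.gcd r₁ b₁ := by
      rw [hr₁, hb₁, Nat.cast_mul, Int.gcd_mul_left, Int.natAbs_natCast]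
    exact Nat.eq_of_mul_eq_mul_left hg0 (by rw [← h1, mul_one])
  obtain ⟨M, hM0, hM⟩ := exists_modulus_forall_logSum_le hB hT hg0 hg (ε := (3 * ((1 : ℝ) + 1))⁻¹)
    (by positivity)
  obtain ⟨p, hp, hprime, hpr⟩ := Nat.forall_exists_prime_gt_and_zmodEq (b₁ * M) hb₁0.ne' hcop
  have hpcop : IsCoprime (p : ℤ) ((b₁ * M : ℕ) : ℤ) :=
    Nat.isCoprime_iff_coprime.2 ((Nat.Prime.coprime_iff_not_dvd hprime).2
      (Nat.not_dvd_of_pos_of_lt (by positivity) hp))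
  have hinf := infinite_setOf_forall_linear_mem hB {(g : ℤ) * p} (L := g * (b₁ * M)) (by positivity) (by
    simp only [Finset.mem_singleton, forall_eq, Finset.card_singleton, Nat.cast_one]
    intro D hD
    have := hM p (b₁ * M) hpcop (Dvd.intro_left _ rfl) D hD
    simpa only [Nat.cast_mul, mul_add, mul_assoc] using this)
  have hinj : Function.Injective fun s : ℕ => g * p + g * (b₁ * M) * s := fun s t hst =>
    Nat.eq_of_mul_eq_mul_left (by positivity) (Nat.add_left_cancel hst)
  refine (hinf.image hinj.injOn).mono ?_
  rintro _ ⟨s, hs, rfl⟩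
  have h1 := hs ((g : ℤ) * p) (Finset.mem_singleton_self _)
  refine ⟨by push_cast at h1 ⊢; exact h1, ?_⟩
  obtain ⟨k, hk⟩ := hpr.symm.dvd
  refine ⟨k + M * s, ?_⟩
  rw [hb₁, hr₁]
  push_cast
  linear_combination (g : ℤ) * hk

/-- A finite set of `B`-free integers has infinitely many `B`-free translates. -/
lemma infinite_setOf_forall_add_mem {B : Set ℕ} (hB : ∀ b ∈ B, 2 ≤ b) (hT : IsTaut B) (Y : Finset ℤ)
    (hY : ∀ n ∈ Y, n ∈ BFreeSet B) : {t : ℕ | ∀ n ∈ Y, n + (t : ℤ) ∈ BFreeSet B}.Infinite := by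
  rcases B.eq_empty_or_nonempty with rfl | ⟨b, hb⟩
  · simpa [BFreeSet] using Set.infinite_univ (α := ℕ)
  have hY0 : ∀ n ∈ Y, 0 < n.natAbs := fun n hn => Int.natAbs_pos.2 fun h0 =>
    hY n hn b hb (h0 ▸ dvd_zero _)
  have hex : ∀ n ∈ Y, ∃ M : ℕ, 0 < M ∧ ∀ (r : ℤ) (L : ℕ), IsCoprime r (L : ℤ) → M ∣ L →
      ∀ D : Finset ℕ, (D : Set ℕ) ⊆ B →
        ∀ᶠ N : ℕ in atTop, logSum {s : ℤ | n.natAbs * (r + L * s) ∉ BFreeSet (D : Set ℕ)} N ≤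
          (3 * ((Y.card : ℝ) + 1))⁻¹ * Real.log N := fun n hn =>
    exists_modulus_forall_logSum_le hB hT (hY0 n hn) (natAbs_mem_BFreeSet.2 (hY n hn)) (by positivity)
  choose! M hM0 hM using hex
  set L := ∏ n ∈ Y, n.natAbs * M n
  have hL : 0 < L := Finset.prod_pos fun n hn => Nat.mul_pos (hY0 n hn) (hM0 n hn)
  have hinf := infinite_setOf_forall_linear_mem hB Y hL fun n hn D hD => by
    obtain ⟨k, hk⟩ : n.natAbs * M n ∣ L := Finset.dvd_prod_of_mem (fun n : ℤ => n.natAbs * M n) hn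
    have hsign : IsUnit n.sign :=
      Int.isUnit_iff_natAbs_eq.2 (Int.natAbs_sign_of_ne_zero (Int.natAbs_pos.1 (hY0 n hn)))
    have h1 := hM n hn n.sign (M n * k) (isCoprime_one_left.of_isCoprime_of_dvd_left hsign.dvd)
      (Dvd.intro _ rfl) D hD
    have h2 : ∀ s : ℤ, (n.natAbs : ℤ) * (n.sign + (M n * k : ℕ) * s) = n + L * s := fun s => by
      have h3 := Int.sign_mul_natAbs n
      rw [hk]
      push_cast at h3 ⊢
      linear_combination h3
    simpa only [h2] using h1
  have hinj : Function.Injective fun s : ℕ => L * s := fun s t hst => Nat.eq_of_mul_eq_mul_left hL hst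
  refine (hinf.image hinj.injOn).mono ?_
  rintro _ ⟨s, hs, rfl⟩ n hn
  have := hs n hn
  push_cast
  exact this

lemma shiftPow_add (s t : ℤ) (x : ℤ → Bool) : shiftPow s (shiftPow t x) = shiftPow (s + t) x := by
  funext n
  simp [shiftPow, add_assoc]

lemma shiftPow_zero (x : ℤ → Bool) : shiftPow 0 x = x := by
  funext n
  simp [shiftPow]

lemma isOpen_setOf_eqOn (J : Finset ℤ) (x : ℤ → Bool) : IsOpen {z : ℤ → Bool | ∀ i ∈ J, z i = x i} := by
  have : {z : ℤ → Bool | ∀ i ∈ J, z i = x i} = ⋂ i ∈ J, {z | z i = x i} := by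
    ext z
    simp
  rw [this]
  exact isOpen_biInter_finset fun i _ => (isOpen_discrete ({x i} : Set Bool)).preimage
    (continuous_apply (A := fun _ : ℤ => Bool) i)

/-- A point lies in the hereditary closure of the `B`-free subshift if and only if each of its finite
patterns has a `B`-free translate. -/
lemma mem_heredClosure_Xeta {B : Set ℕ} {y : ℤ → Bool} :
    y ∈ heredClosure (Xeta B) ↔ ∀ J : Finset ℤ, ∃ t : ℤ, ∀ i ∈ J, y i = true → i + t ∈ BFreeSet B := by
  constructor
  · rintro ⟨x, hx, hyx⟩ J
    obtain ⟨z, hz, t, rfl⟩ := mem_closure_iff.1 hx _ (isOpen_setOf_eqOn J x) fun i _ => rfl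
    refine ⟨t, fun i hi hyi => ?_⟩
    have h1 : x i = true := by
      have := hyx i
      rw [hyi] at this
      exact top_le_iff.1 this
    have h2 : shiftPow t (eta B) i = true := (hz i hi).trans h1
    by_contra h3
    simp [shiftPow, eta, h3] at h2
  · intro h
    let K : Finset ℤ → Set (ℤ → Bool) := fun J => Xeta B ∩ {z | ∀ i ∈ J, y i ≤ z i}
    have hclosed : ∀ J, IsClosed (K J) := fun J => by
      refine isClosed_closure.inter ?_
      have : {z : ℤ → Bool | ∀ i ∈ J, y i ≤ z i} = ⋂ i ∈ J, {z | y i ≤ z i} := by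
        ext z
        simp
      rw [this]
      exact isClosed_biInter fun i _ => (isClosed_discrete (Ici (y i))).preimage
        (continuous_apply (A := fun _ : ℤ => Bool) i)
    obtain ⟨x, hx⟩ := IsCompact.nonempty_iInter_of_directed_nonempty_isCompact_isClosed K
      (directed_of_isDirected_le fun J J' hJ z hz => ⟨hz.1, fun i hi => hz.2 i (Finset.mem_of_subset hJ hi)⟩)
      (fun J => by
        obtain ⟨t, ht⟩ := h J
        refine ⟨shiftPow t (eta B), subset_closure ⟨t, rfl⟩, fun i hi => ?_⟩
        cases hyi : y i
        · exact Bool.false_le _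
        · simp [shiftPow, eta, ht i hi hyi])
      (fun J => (hclosed J).isCompact) hclosed
    rw [mem_iInter] at hx
    exact ⟨x, (hx ∅).1, fun n => (hx {n}).2 n (Finset.mem_singleton_self n)⟩

lemma mem_heredClosure_of_translate {B : Set ℕ} {y : ℤ → Bool} (t : ℤ)
    (h : ∀ i, y i = true → i + t ∈ BFreeSet B) : y ∈ heredClosure (Xeta B) :=
  mem_heredClosure_Xeta.2 fun _ => ⟨t, fun i _ => h i⟩

lemma shiftPow_mem_heredClosure {B : Set ℕ} {y : ℤ → Bool} (t : ℤ) (hy : y ∈ heredClosure (Xeta B)) :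
    shiftPow t y ∈ heredClosure (Xeta B) := by
  rw [mem_heredClosure_Xeta] at *
  intro J
  obtain ⟨s, hs⟩ := hy (J.image (· + t))
  refine ⟨t + s, fun i hi hyi => ?_⟩
  rw [← add_assoc]
  exact hs _ (Finset.mem_image_of_mem _ hi) hyi

lemma isCompact_heredClosure_Xeta (B : Set ℕ) : IsCompact (heredClosure (Xeta B)) := by
  refine IsClosed.isCompact (isOpen_compl_iff.1 (isOpen_iff_forall_mem_open.2 fun y hy => ?_))
  rw [mem_compl_iff, mem_heredClosure_Xeta] at hy
  push Not at hy
  obtain ⟨J, hJ⟩ := hy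
  refine ⟨_, fun z hz => ?_, isOpen_setOf_eqOn J y, fun i _ => rfl⟩
  rw [mem_compl_iff, mem_heredClosure_Xeta]
  push Not
  refine ⟨J, fun t => ?_⟩
  obtain ⟨i, hi, hyi, hit⟩ := hJ t
  exact ⟨i, hi, (hz i hi).trans hyi, hit⟩

/-- Points of the hereditary closure have `B`-admissible supports. -/
lemma exists_residue_of_mem_heredClosure {B : Set ℕ} {y : ℤ → Bool} (hy : y ∈ heredClosure (Xeta B))
    {b : ℕ} (hb : b ∈ B) (hb0 : 0 < b) : ∃ r : ℤ, ∀ i, y i = true → ¬ (b : ℤ) ∣ i - r := by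
  by_contra hcon
  push Not at hcon
  choose f hf hfd using hcon
  obtain ⟨t, ht⟩ := mem_heredClosure_Xeta.1 hy ((Finset.Ico (0 : ℤ) b).image f)
  have hb' : (0 : ℤ) < b := by exact_mod_cast hb0
  have hmem : (-t) % (b : ℤ) ∈ Finset.Ico (0 : ℤ) b :=
    Finset.mem_Ico.2 ⟨Int.emod_nonneg _ hb'.ne', Int.emod_lt_of_pos _ hb'⟩
  refine ht _ (Finset.mem_image_of_mem f hmem) (hf _) b hb ?_
  have h1 := hfd ((-t) % (b : ℤ))
  have h2 : (b : ℤ) ∣ (-t) % (b : ℤ) - (-t) := (Int.mod_modEq (-t) b).symm.dvd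
  have := dvd_add h1 h2
  rwa [show f ((-t) % (b : ℤ)) - (-t) % (b : ℤ) + ((-t) % (b : ℤ) - -t) = f ((-t) % (b : ℤ)) + t by ring] at this

lemma IsCA.map_shiftPow {B : Set ℕ} {τ : (ℤ → Bool) → (ℤ → Bool)} (hτ : IsCA (heredClosure (Xeta B)) τ)
    {x : ℤ → Bool} (hx : x ∈ heredClosure (Xeta B)) (t : ℤ) : τ (shiftPow t x) = shiftPow t (τ x) := by
  have hnat : ∀ (k : ℕ) (x : ℤ → Bool), x ∈ heredClosure (Xeta B) →
      τ (shiftPow k x) = shiftPow k (τ x) := by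
    intro k
    induction k with
    | zero => intro x _; simp [shiftPow_zero]
    | succ k ih =>
      intro x hx
      have h1 := hτ.2.2 _ (shiftPow_mem_heredClosure k hx)
      rw [shift, shiftPow_add, ih x hx, shiftPow_add] at h1
      rwa [Nat.cast_succ, add_comm]
  obtain ⟨k, rfl | rfl⟩ := t.eq_nat_or_neg
  · exact hnat k x hx
  · have h1 := hnat k _ (shiftPow_mem_heredClosure (-k) hx)
    rw [shiftPow_add, add_neg_cancel, shiftPow_zero] at h1
    rw [h1, shiftPow_add, neg_add_cancel, shiftPow_zero]

/-- The Curtis-Hedlund-Lyndon theorem. -/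
lemma IsCA.exists_hasRadius {B : Set ℕ} {τ : (ℤ → Bool) → (ℤ → Bool)}
    (hτ : IsCA (heredClosure (Xeta B)) τ) : ∃ ℓ : ℕ, HasRadius (heredClosure (Xeta B)) τ ℓ := by
  set X := heredClosure (Xeta B)
  have hX : IsCompact X := isCompact_heredClosure_Xeta B
  have hcont : ContinuousOn (fun p : (ℤ → Bool) × (ℤ → Bool) => (τ p.1 0, τ p.2 0)) (X ×ˢ X) :=
    ContinuousOn.prodMk
      ((continuous_apply 0).comp_continuousOn (hτ.2.1.comp continuousOn_fst fun p hp => hp.1))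
      ((continuous_apply 0).comp_continuousOn (hτ.2.1.comp continuousOn_snd fun p hp => hp.2))
  have hK := hcont.preimage_isClosed_of_isClosed (hX.prod hX).isClosed
    (isClosed_discrete {q : Bool × Bool | q.1 ≠ q.2})
  obtain ⟨u, hu⟩ := hK.isCompact.elim_finite_subfamily_closed
    (fun i : ℤ => {p : (ℤ → Bool) × (ℤ → Bool) | p.1 i = p.2 i})
    (fun i => isClosed_eq ((continuous_apply i).comp continuous_fst) ((continuous_apply i).comp continuous_snd))
    (by
      refine eq_empty_iff_forall_notMem.2 fun p hp => hp.1.2 ?_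
      have : p.1 = p.2 := funext fun i => mem_iInter.1 hp.2 i
      show τ p.1 0 = τ p.2 0
      rw [this])
  refine ⟨u.sup Int.natAbs, fun x hx y hy n hxy => ?_⟩
  by_contra hne
  refine (eq_empty_iff_forall_notMem.1 hu) (shiftPow n x, shiftPow n y) ⟨⟨⟨shiftPow_mem_heredClosure n hx,
    shiftPow_mem_heredClosure n hy⟩, ?_⟩, ?_⟩
  · show τ (shiftPow n x) 0 ≠ τ (shiftPow n y) 0
    rw [hτ.map_shiftPow hx, hτ.map_shiftPow hy]
    simpa [shiftPow] using hne
  · refine mem_iInter₂.2 fun i hi => ?_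
    have : i.natAbs ≤ u.sup Int.natAbs := Finset.le_sup hi
    exact hxy _ (by omega) (by omega)

lemma exists_sparse_seq {S : ℕ → Set ℕ} (hS : ∀ r, (S r).Infinite) (K : ℕ) :
    ∃ m : ℕ → ℕ, (∀ r, m r ∈ S r) ∧ (∀ r, K < m r) ∧ ∀ r r', r < r' → m r + K < m r' := by
  choose f hf hfK using fun r k => (hS r).exists_gt k
  let m : ℕ → ℕ := fun r => Nat.rec (f 0 K) (fun r v => f (r + 1) (v + K)) r
  have hstep : ∀ r, m r + K < m (r + 1) := fun r => hfK (r + 1) (m r + K)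
  have hmono : StrictMono m := strictMono_nat_of_lt_succ fun r => (Nat.le_add_right _ K).trans_lt (hstep r)
  refine ⟨m, fun r => ?_, fun r => ?_, fun r r' hr => (hstep r).trans_le (hmono.monotone hr)⟩
  · cases r with
    | zero => exact hf 0 K
    | succ r => exact hf (r + 1) (m r + K)
  · exact (hfK 0 K).trans_le (hmono.monotone (Nat.zero_le r))

/-- Subsets of `W` avoiding one pattern on each of `k` disjoint windows are exponentially rare in `k`. -/
lemma card_filter_avoid_le (k q : ℕ) {J Y : ℕ → Finset ℤ} (hJ : ∀ r r', r < r' → Disjoint (J r) (J r'))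
    (hq : ∀ r, (J r).card ≤ q) (W : Finset ℤ) (hY : ∀ r < k, Y r ⊆ W ∩ J r) :
    ((W.powerset.filter fun Z => ∀ r < k, Z ∩ J r ≠ Y r).card : ℝ) ≤
      2 ^ W.card * (1 - (1 / 2) ^ q) ^ k := by
  induction k generalizing W with
  | zero => simp
  | succ k ih =>
    have hdis : ∀ r < k, ∀ Z : Finset ℤ, (Z \ J k) ∩ J r = Z ∩ J r := fun r hr Z => by
      have h1 := Finset.disjoint_left.1 (hJ r k hr)
      ext i
      simp only [Finset.mem_inter, Finset.mem_sdiff]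
      exact ⟨fun h => ⟨h.1.1, h.2⟩, fun h => ⟨⟨h.1, h1 h.2⟩, h.2⟩⟩
    have hle : (W.powerset.filter fun Z => ∀ r < k + 1, Z ∩ J r ≠ Y r).card ≤
        (((W ∩ J k).powerset.erase (Y k)) ×ˢ
          ((W \ J k).powerset.filter fun Z => ∀ r < k, Z ∩ J r ≠ Y r)).card := by
      refine Finset.card_le_card_of_injOn (fun Z => (Z ∩ J k, Z \ J k)) (fun Z hZ => ?_) ?_
      · rw [Finset.mem_coe, Finset.mem_filter, Finset.mem_powerset] at hZ
        rw [Finset.mem_coe, Finset.mem_product, Finset.mem_erase, Finset.mem_powerset, Finset.mem_filter,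
          Finset.mem_powerset]
        refine ⟨⟨hZ.2 k (Nat.lt_succ_self k), Finset.inter_subset_inter_right hZ.1⟩,
          Finset.sdiff_subset_sdiff hZ.1 subset_rfl, fun r hr => ?_⟩
        rw [hdis r hr]
        exact hZ.2 r (hr.trans (Nat.lt_succ_self k))
      · intro Z _ Z' _ h
        rw [Prod.mk.injEq] at h
        rw [← Finset.sdiff_union_inter Z (J k), h.1, h.2, Finset.sdiff_union_inter]
    have h1 := ih (W \ J k) fun r hr => by
      rw [hdis r hr]
      exact hY r (hr.trans (Nat.lt_succ_self k))
    have h2 : (((W ∩ J k).powerset.erase (Y k)).card : ℝ) ≤ 2 ^ (W ∩ J k).card * (1 - (1 / 2) ^ q) := by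
      rw [Finset.card_erase_of_mem (Finset.mem_powerset.2 (hY k (Nat.lt_succ_self k))), Finset.card_powerset,
        Nat.cast_sub Nat.one_le_two_pow]
      have h3 : (1 / 2 : ℝ) ^ q ≤ (1 / 2) ^ (W ∩ J k).card :=
        pow_le_pow_of_le_one (by norm_num) (by norm_num)
          ((Finset.card_le_card Finset.inter_subset_right).trans (hq k))
      have h4 : (2 : ℝ) ^ (W ∩ J k).card * (1 / 2) ^ (W ∩ J k).card = 1 := by
        rw [← mul_pow]; norm_num
      have h5 := mul_le_mul_of_nonneg_left h3 (show (0 : ℝ) ≤ 2 ^ (W ∩ J k).card by positivity)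
      push_cast
      linarith
    have h3 : (0 : ℝ) ≤ 1 - (1 / 2) ^ q := sub_nonneg.2 (pow_le_one₀ (by norm_num) (by norm_num))
    calc _ ≤ (((W ∩ J k).powerset.erase (Y k)).card : ℝ) *
          ((W \ J k).powerset.filter fun Z => ∀ r < k, Z ∩ J r ≠ Y r).card := by
          rw [← Nat.cast_mul, ← Finset.card_product]
          exact_mod_cast hle
      _ ≤ (2 ^ (W ∩ J k).card * (1 - (1 / 2) ^ q)) * (2 ^ (W \ J k).card * (1 - (1 / 2) ^ q) ^ k) :=
          mul_le_mul h2 h1 (Nat.cast_nonneg _) (by positivity)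
      _ = 2 ^ W.card * (1 - (1 / 2) ^ q) ^ (k + 1) := by
          rw [← Finset.card_inter_add_card_sdiff W (J k)]
          ring

lemma zeroSeq_mem_heredClosure {B : Set ℕ} : zeroSeq ∈ heredClosure (Xeta B) :=
  mem_heredClosure_of_translate 0 fun i hi => by simp [zeroSeq] at hi

lemma one_mem_BFreeSet {B : Set ℕ} (hB : ∀ b ∈ B, 2 ≤ b) : (1 : ℤ) ∈ BFreeSet B := fun b hb h => by
  have h1 := Int.le_of_dvd one_pos h
  have h2 := hB b hb
  omega

lemma shiftPow_uSeq (t i : ℤ) : shiftPow (-t) uSeq i = decide (i = t) := by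
  simp only [shiftPow, uSeq, ← sub_eq_add_neg, sub_eq_zero]
  split_ifs with h <;> simp [h]

lemma uSeq_mem_heredClosure {B : Set ℕ} (hB : ∀ b ∈ B, 2 ≤ b) : uSeq ∈ heredClosure (Xeta B) :=
  mem_heredClosure_of_translate 1 fun i hi => by
    have : i = 0 := by simpa [uSeq] using hi
    rw [this, zero_add]
    exact one_mem_BFreeSet hB

lemma IsCA.apply_zeroSeq {B : Set ℕ} {τ : (ℤ → Bool) → (ℤ → Bool)} (hB : ∀ b ∈ B, 2 ≤ b) (hne : B.Nonempty)
    (hτ : IsCA (heredClosure (Xeta B)) τ) : τ zeroSeq = zeroSeq := by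
  obtain ⟨b, hb⟩ := hne
  obtain ⟨r, hr⟩ := exists_residue_of_mem_heredClosure (hτ.1 zeroSeq_mem_heredClosure) hb
    (two_pos.trans_le (hB b hb))
  have h1 : τ zeroSeq r = false := by
    rw [← Bool.not_eq_true]
    exact fun h => hr r h (by simp)
  funext n
  have h2 := congrFun (hτ.map_shiftPow zeroSeq_mem_heredClosure (n - r)) r
  have h3 : shiftPow (n - r) zeroSeq = zeroSeq := rfl
  rw [h3, h1] at h2
  simpa [shiftPow, zeroSeq] using h2.symm

lemma IsCA.exists_apply_uSeq {B : Set ℕ} {τ : (ℤ → Bool) → (ℤ → Bool)} (hB : ∀ b ∈ B, 2 ≤ b) (hne : B.Nonempty)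
    (hτ : IsCA (heredClosure (Xeta B)) τ) (hpre : PreInjective (heredClosure (Xeta B)) τ) :
    ∃ a : ℤ, τ uSeq a = true := by
  by_contra hcon
  push Not at hcon
  have h1 : τ uSeq = τ zeroSeq := by
    rw [hτ.apply_zeroSeq hB hne]
    exact funext fun n => by simpa [zeroSeq] using hcon n
  have h2 := hpre _ (uSeq_mem_heredClosure hB) _ zeroSeq_mem_heredClosure h1
    ((finite_singleton (0 : ℤ)).subset fun n hn => by
      by_contra h
      exact hn (by simp [uSeq, zeroSeq, show n ≠ 0 from h]))
  simpa [uSeq, zeroSeq] using congrFun h2 0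

/-- Up to a translation, a pre-injective cellular automaton maps configurations supported on the `B`-free
integers and bounded above to configurations supported on the `B`-free integers. -/
lemma IsCA.exists_offset {B : Set ℕ} {τ : (ℤ → Bool) → (ℤ → Bool)} (hB : ∀ b ∈ B, 2 ≤ b) (hP : Primitive B)
    (hT : IsTaut B) (hτ : IsCA (heredClosure (Xeta B)) τ) (hpre : PreInjective (heredClosure (Xeta B)) τ) :
    ∃ a : ℤ, ∀ (x : ℤ → Bool) (K : ℤ), (∀ i, x i = true → i ∈ BFreeSet B ∧ i ≤ K) →
      ∀ n, τ x n = true → n - a ∈ BFreeSet B := by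
  classical
  obtain rfl | hne := B.eq_empty_or_nonempty
  · exact ⟨0, fun x K _ n _ b hb => absurd hb (notMem_empty b)⟩
  obtain ⟨a, ha⟩ := hτ.exists_apply_uSeq hB hne hpre
  obtain ⟨ℓ, hℓ⟩ := hτ.exists_hasRadius
  refine ⟨a, fun x K hx n hn b hb hdvd => ?_⟩
  let S : ℕ → Set ℕ := fun r => {m : ℕ | ¬ (b : ℤ) ∣ (r : ℤ) → (m : ℤ) ∈ BFreeSet B ∧ (b : ℤ) ∣ m - r}
  have hS : ∀ r, (S r).Infinite := fun r => by
    by_cases hr : (b : ℤ) ∣ (r : ℤ)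
    · exact infinite_univ.mono fun m _ h => absurd hr h
    · exact (infinite_setOf_mem_BFreeSet_dvd_sub hB hP hT hb hr).mono fun m hm _ => hm
  obtain ⟨m, hmS, hmK, hmm⟩ := exists_sparse_seq hS (K.toNat + n.natAbs + a.natAbs + ℓ)
  let x' : ℤ → Bool := fun i => x i || decide (∃ r : ℕ, ¬ (b : ℤ) ∣ (r : ℤ) ∧ i = m r)
  have hx' : x' ∈ heredClosure (Xeta B) := mem_heredClosure_of_translate 0 fun i hi => by
    rw [add_zero]
    rcases (Bool.or_eq_true _ _).mp hi with h | h
    · exact (hx i h).1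
    · obtain ⟨r, hr, rfl⟩ := of_decide_eq_true h
      exact (hmS r hr).1
  have hxX : x ∈ heredClosure (Xeta B) := mem_heredClosure_of_translate 0 fun i hi => by
    rw [add_zero]
    exact (hx i hi).1
  have hn' : τ x' n = true := by
    rw [← hn]
    refine hℓ _ hx' _ hxX n fun i hi1 hi2 => ?_
    have : ¬ ∃ r : ℕ, ¬ (b : ℤ) ∣ (r : ℤ) ∧ i = m r := fun ⟨r, _, hr⟩ => by
      have := hmK r
      omega
    simp only [x', decide_eq_false this, Bool.or_false]
  have hm' : ∀ r : ℕ, ¬ (b : ℤ) ∣ (r : ℤ) → τ x' (m r + a) = true := fun r hr => by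
    have h1 : τ (shiftPow (-(m r : ℤ)) uSeq) (m r + a) = true := by
      rw [hτ.map_shiftPow (uSeq_mem_heredClosure hB), shiftPow, ← ha]
      congr 1
      ring
    rw [← h1]
    refine hℓ _ hx' _ (shiftPow_mem_heredClosure _ (uSeq_mem_heredClosure hB)) _ fun i hi1 hi2 => ?_
    have hKr := hmK r
    have h2 : x i = false := by
      rw [← Bool.not_eq_true]
      intro h
      have := (hx i h).2
      omega
    rw [shiftPow_uSeq]
    simp only [x', h2, Bool.false_or, decide_eq_decide]
    refine ⟨fun ⟨r', _, hi⟩ => ?_, fun hi => ⟨r, hr, hi⟩⟩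
    obtain h | rfl | h := lt_trichotomy r r'
    · have := hmm r r' h
      omega
    · exact hi
    · have := hmm r' r h
      omega
  have hb0 : 0 < b := two_pos.trans_le (hB b hb)
  have hb0' : (b : ℤ) ≠ 0 := by exact_mod_cast hb0.ne'
  obtain ⟨ρ, hρ⟩ := exists_residue_of_mem_heredClosure (hτ.1 hx') hb hb0
  obtain ⟨r, hr⟩ := Int.eq_ofNat_of_zero_le (Int.emod_nonneg (ρ - a) hb0')
  have hrρ : (b : ℤ) ∣ (r : ℤ) - (ρ - a) := by
    rw [← hr]
    exact (Int.mod_modEq (ρ - a) b).symm.dvd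
  by_cases hbr : (b : ℤ) ∣ (r : ℤ)
  · refine hρ n hn' ?_
    have := dvd_sub (dvd_add hdvd hrρ) hbr
    rwa [show n - a + ((r : ℤ) - (ρ - a)) - r = n - ρ by ring] at this
  · refine hρ _ (hm' r hbr) ?_
    have := dvd_add (hmS r hbr).2 hrρ
    rwa [show (m r : ℤ) - r + ((r : ℤ) - (ρ - a)) = m r + a - ρ by ring] at this

/-- A point outside the image of a cellular automaton is excluded from it by a finite pattern. -/
lemma IsCA.exists_finset_forall_ne {B : Set ℕ} {τ : (ℤ → Bool) → (ℤ → Bool)} {y : ℤ → Bool}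
    (hτ : IsCA (heredClosure (Xeta B)) τ) (hy : y ∉ τ '' heredClosure (Xeta B)) :
    ∃ J : Finset ℤ, ∀ x ∈ heredClosure (Xeta B), ∃ i ∈ J, τ x i ≠ y i := by
  have hcl := ((isCompact_heredClosure_Xeta B).image_of_continuousOn hτ.2.1).isClosed
  obtain ⟨J, u, hu, hJ⟩ := isOpen_pi_iff.1 hcl.isOpen_compl y hy
  refine ⟨J, fun x hx => ?_⟩
  by_contra hcon
  push Not at hcon
  exact hJ (fun i hi => by rw [hcon i hi]; exact (hu i hi).2) (mem_image_of_mem τ hx)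

/-- Every finite pattern of the hereditary closure has arbitrarily sparse `B`-free translates. -/
lemma exists_disjoint_translates {B : Set ℕ} (hB : ∀ b ∈ B, 2 ≤ b) (hT : IsTaut B) {y : ℤ → Bool}
    (hy : y ∈ heredClosure (Xeta B)) (J : Finset ℤ) (a : ℤ) :
    ∃ e : ℕ → ℤ, (∀ r, ∀ i ∈ J, y i = true → i + e r - a ∈ BFreeSet B) ∧ (∀ r, ∀ i ∈ J, 1 ≤ i + e r) ∧
      ∀ r r', r < r' → Disjoint (J.image (· + e r)) (J.image (· + e r')) := by
  obtain ⟨t, ht⟩ := mem_heredClosure_Xeta.1 hy J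
  have hinf := infinite_setOf_forall_add_mem hB hT ((J.filter fun i => y i = true).image (· + t)) fun n hn => by
    obtain ⟨i, hi, rfl⟩ := Finset.mem_image.1 hn
    exact ht i (Finset.mem_filter.1 hi).1 (Finset.mem_filter.1 hi).2
  obtain ⟨m, hmS, hmK, hmm⟩ := exists_sparse_seq (fun _ : ℕ => hinf)
    (2 * J.sup Int.natAbs + t.natAbs + a.natAbs)
  have hD : ∀ i ∈ J, i.natAbs ≤ J.sup Int.natAbs := fun i hi => Finset.le_sup hi
  refine ⟨fun r => t + m r + a, fun r i hi hyi => ?_, fun r i hi => ?_, fun r r' hr => ?_⟩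
  · have := hmS r (i + t) (Finset.mem_image_of_mem _ (Finset.mem_filter.2 ⟨hi, hyi⟩))
    rwa [show i + (t + m r + a) - a = i + t + m r by ring]
  · have h1 := hD i hi
    have h2 := hmK r
    show 1 ≤ i + (t + m r + a)
    omega
  · rw [Finset.disjoint_left]
    intro n hn hn'
    obtain ⟨i, hi, rfl⟩ := Finset.mem_image.1 hn
    obtain ⟨i', hi', h⟩ := Finset.mem_image.1 hn'
    have h1 := hD i hi
    have h2 := hD i' hi'
    have h3 := hmm r r' hr
    simp only at h
    omega

lemma card_filter_translate_le (p : ℤ → Prop) [DecidablePred p] (a : ℤ) (ℓ N : ℕ) :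
    ((Finset.Icc (1 - (ℓ : ℤ)) (N + ℓ)).filter fun n => p (n - a)).card ≤
      ((Finset.Icc (1 : ℤ) N).filter p).card + 2 * (ℓ + a.natAbs) := by
  have hsub : ((Finset.Icc (1 - (ℓ : ℤ)) (N + ℓ)).filter fun n => p (n - a)).image (· - a) ⊆
      (Finset.Icc (1 : ℤ) N).filter p ∪ (Finset.Icc (1 - ((ℓ + a.natAbs : ℕ) : ℤ)) 0 ∪
        Finset.Icc ((N : ℤ) + 1) (N + (ℓ + a.natAbs : ℕ))) := by
    intro n hn
    obtain ⟨i, hi, rfl⟩ := Finset.mem_image.1 hn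
    rw [Finset.mem_filter, Finset.mem_Icc] at hi
    simp only [Finset.mem_union, Finset.mem_filter, Finset.mem_Icc]
    by_cases h1 : i - a ≤ 0
    · exact Or.inr (Or.inl (by omega))
    · by_cases h2 : i - a ≤ N
      · exact Or.inl ⟨by omega, hi.2⟩
      · exact Or.inr (Or.inr (by omega))
  rw [← Finset.card_image_of_injective _ (sub_left_injective (b := a))]
  refine (Finset.card_le_card hsub).trans ((Finset.card_union_le _ _).trans
    (Nat.add_le_add_left ((Finset.card_union_le _ _).trans ?_) _))
  simp only [Int.card_Icc]
  omega

open Classical in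
/-- A pre-injective cellular automaton embeds the subsets of the `B`-free integers of a window into the
subsets of a slightly larger window. -/
lemma PreInjective.two_pow_card_le {B : Set ℕ} {τ : (ℤ → Bool) → (ℤ → Bool)}
    (hpre : PreInjective (heredClosure (Xeta B)) τ) {ℓ : ℕ} (hℓ : HasRadius (heredClosure (Xeta B)) τ ℓ)
    {a : ℤ} (ha : ∀ (x : ℤ → Bool) (K : ℤ), (∀ i, x i = true → i ∈ BFreeSet B ∧ i ≤ K) →
      ∀ n, τ x n = true → n - a ∈ BFreeSet B) (N : ℕ) {F : Finset (Finset ℤ)}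
    (hF : ∀ x ∈ heredClosure (Xeta B), (∀ n, τ x n = true → n - a ∈ BFreeSet B) → (((Finset.Icc (1 - (ℓ : ℤ)) (N + ℓ)).filter
      fun n => n - a ∈ BFreeSet B).filter fun n => τ x n = true) ∈ F) :
    2 ^ ((Finset.Icc (1 : ℤ) N).filter fun n => n ∈ BFreeSet B).card ≤ F.card := by
  rw [← Finset.card_powerset]
  set P := (Finset.Icc (1 : ℤ) N).filter fun n => n ∈ BFreeSet B
  let c : Finset ℤ → ℤ → Bool := fun A i => decide (i ∈ A)
  have hP : ∀ A ⊆ P, ∀ i, c A i = true → i ∈ BFreeSet B ∧ 1 ≤ i ∧ i ≤ N := fun A hA i hi => by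
    have h := Finset.mem_filter.1 (hA (of_decide_eq_true hi))
    exact ⟨h.2, Finset.mem_Icc.1 h.1⟩
  have hX : ∀ A ⊆ P, c A ∈ heredClosure (Xeta B) := fun A hA =>
    mem_heredClosure_of_translate 0 fun i hi => by
      rw [add_zero]
      exact (hP A hA i hi).1
  have hval : ∀ A ⊆ P, ∀ n, (τ (c A) n = true → n - a ∈ BFreeSet B) := fun A hA =>
    ha (c A) N fun i hi => ⟨(hP A hA i hi).1, (hP A hA i hi).2.2⟩
  refine Finset.card_le_card_of_injOn (fun A => ((Finset.Icc (1 - (ℓ : ℤ)) (N + ℓ)).filter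
    fun n => n - a ∈ BFreeSet B).filter fun n => τ (c A) n = true)
    (fun A hA => hF _ (hX A (Finset.mem_powerset.1 hA)) (hval A (Finset.mem_powerset.1 hA))) fun A hA A' hA' h => ?_
  rw [Finset.mem_coe, Finset.mem_powerset] at hA hA'
  have hcc : c A = c A' := by
    refine hpre _ (hX A hA) _ (hX A' hA') (funext fun n => ?_) ((A ∪ A').finite_toSet.subset fun i hi => ?_)
    · by_cases hn : n ∈ Finset.Icc (1 - (ℓ : ℤ)) (N + ℓ)
      · have h1 := Finset.ext_iff.1 h n
        simp only [Finset.mem_filter, hn, true_and] at h1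
        rw [Bool.eq_iff_iff]
        exact ⟨fun h2 => (h1.1 ⟨hval A hA n h2, h2⟩).2, fun h2 => (h1.2 ⟨hval A' hA' n h2, h2⟩).2⟩
      · have hzero : ∀ A ⊆ P, ∀ i, n - ℓ ≤ i → i ≤ n + ℓ → c A i = false := fun A hA i h1 h2 => by
          rw [← Bool.not_eq_true]
          intro h3
          have h4 := hP A hA i h3
          rw [Finset.mem_Icc] at hn
          omega
        exact hℓ _ (hX A hA) _ (hX A' hA') n fun i h1 h2 => by rw [hzero A hA i h1 h2, hzero A' hA' i h1 h2]
    · by_contra hi'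
      rw [Finset.mem_coe, Finset.mem_union, not_or] at hi'
      exact hi (by simp only [c, hi'.1, hi'.2])
  ext i
  simpa [c] using congrFun hcc i

/-- if `B` is taut, the hereditary closure of the `B`-free subshift has the
Myhill property: every pre-injective CA on it is surjective. -/
theorem myhill_hereditary_closure_of_taut (B : Set ℕ)
    (hBpos : ∀ b ∈ B, 2 ≤ b) (hBprim : Primitive B) (htaut : IsTaut B)
    (τ : (ℤ → Bool) → (ℤ → Bool)) (hτ : IsCA (heredClosure (Xeta B)) τ)
    (hpre : PreInjective (heredClosure (Xeta B)) τ) :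
    Set.SurjOn τ (heredClosure (Xeta B)) (heredClosure (Xeta B)) := by
  classical
  intro y hy
  by_contra hyn
  obtain ⟨J, hJ⟩ := hτ.exists_finset_forall_ne hyn
  obtain ⟨ℓ, hℓ⟩ := hτ.exists_hasRadius
  obtain ⟨a, ha⟩ := hτ.exists_offset hBpos hBprim htaut hpre
  obtain ⟨e, heF, hepos, hedisj⟩ := exists_disjoint_translates hBpos htaut hy J a
  have hlt : (1 - (1 / 2) ^ J.card : ℝ) < 1 := sub_lt_self 1 (by positivity)
  obtain ⟨k, hk⟩ := exists_pow_lt_of_lt_one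
    (show (0 : ℝ) < ((2 : ℝ) ^ (2 * (ℓ + a.natAbs)))⁻¹ by positivity) hlt
  let N : ℕ := (Finset.range k).sup fun r => J.sup fun i => (i + e r).natAbs
  have hN : ∀ r < k, ∀ i ∈ J, (i + e r).natAbs ≤ N := fun r hr i hi =>
    (Finset.le_sup (f := fun i => (i + e r).natAbs) hi).trans
      (Finset.le_sup (f := fun r => J.sup fun i => (i + e r).natAbs) (Finset.mem_range.2 hr))
  set W := (Finset.Icc (1 - (ℓ : ℤ)) (N + ℓ)).filter fun n => n - a ∈ BFreeSet B with hW
  let Y : ℕ → Finset ℤ := fun r => (J.filter fun i => y i = true).image (· + e r)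
  have hY : ∀ r < k, Y r ⊆ W ∩ J.image (· + e r) := fun r hr n hn => by
    obtain ⟨i, hi, rfl⟩ := Finset.mem_image.1 hn
    obtain ⟨hiJ, hyi⟩ := Finset.mem_filter.1 hi
    have h1 := hepos r i hiJ
    have h2 := hN r hr i hiJ
    refine Finset.mem_inter.2 ⟨Finset.mem_filter.2 ⟨Finset.mem_Icc.2 ⟨?_, ?_⟩, heF r i hiJ hyi⟩,
      Finset.mem_image_of_mem _ hiJ⟩ <;> omega
  have hcount := hpre.two_pow_card_le hℓ ha N
    (F := W.powerset.filter fun Z => ∀ r < k, Z ∩ J.image (· + e r) ≠ Y r) fun x hx hτx => by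
      refine Finset.mem_filter.2 ⟨Finset.mem_powerset.2 (Finset.filter_subset _ _), fun r hr heq => ?_⟩
      obtain ⟨i, hi, hne⟩ := hJ _ (shiftPow_mem_heredClosure (e r) hx)
      rw [hτ.map_shiftPow hx] at hne
      refine hne (Bool.eq_iff_iff.2 ⟨fun h => ?_, fun h => ?_⟩)
      · have h1 := hepos r i hi
        have h2 := hN r hr i hi
        have hmem : i + e r ∈ Y r := by
          rw [← heq]
          exact Finset.mem_inter.2 ⟨Finset.mem_filter.2 ⟨Finset.mem_filter.2
            ⟨Finset.mem_Icc.2 ⟨by omega, by omega⟩, hτx _ h⟩, h⟩, Finset.mem_image_of_mem _ hi⟩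
        obtain ⟨j, hj, hje⟩ := Finset.mem_image.1 hmem
        obtain rfl : j = i := add_right_cancel hje
        exact (Finset.mem_filter.1 hj).2
      · have hmem : i + e r ∈ Y r := Finset.mem_image_of_mem _ (Finset.mem_filter.2 ⟨hi, h⟩)
        rw [← heq] at hmem
        exact (Finset.mem_filter.1 (Finset.mem_inter.1 hmem).1).2
  have hfam := card_filter_avoid_le k J.card hedisj (fun r => Finset.card_image_le) W hY
  have hWcard := card_filter_translate_le (· ∈ BFreeSet B) a ℓ N
  set P := (Finset.Icc (1 : ℤ) N).filter fun n => n ∈ BFreeSet B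
  have h1 : (2 : ℝ) ^ P.card ≤ 2 ^ W.card * (1 - (1 / 2) ^ J.card) ^ k :=
    le_trans (by exact_mod_cast hcount) hfam
  have h2 : (2 : ℝ) ^ W.card ≤ 2 ^ P.card * 2 ^ (2 * (ℓ + a.natAbs)) := by
    rw [← pow_add]
    exact pow_le_pow_right₀ one_le_two hWcard
  have h3 : (2 : ℝ) ^ W.card * (1 - (1 / 2) ^ J.card) ^ k < 2 ^ P.card := by
    calc _ < (2 : ℝ) ^ W.card * ((2 : ℝ) ^ (2 * (ℓ + a.natAbs)))⁻¹ :=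
          mul_lt_mul_of_pos_left hk (by positivity)
      _ ≤ 2 ^ P.card := by
          rwa [← div_eq_mul_inv, div_le_iff₀ (by positivity)]
  exact absurd h1 (not_le.2 h3)
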